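/- arXiv:1211.2374 — 2 statements merged into one kernel-verified Lean document; each statement's English description precedes it below -/
import Mathlib

section
/- Let $d \ge 3$ and let $G$ be an infinite, connected, $d$-regular, vertex-transitive simple graph. Suppose there exists a finite vertex set $A$ with $|A| \ge 2$ having exactly $d$ edges between $A$ and its complement (i.e., $d$ is the smallest size of the edge boundary of a finite vertex set with at least $2$ elements). Then $G$ has a perfect matching that is invariant under every automorphism of $G$; namely, every vertex lies in a unique $d$-clique (a set of $d$ pairwise adjacent vertices), exactly one edge at each vertex leaves its $d$-clique, and the set consisting of, for each vertex, the unique edge at that vertex leaving its $d$-clique, is such a perfect matching. -/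
namespace PaperPM

/-- The set of edges of `G` between `A` and its complement. -/
def cutEdges {V : Type*} (G : SimpleGraph V) (A : Set V) : Set (Sym2 V) :=
  {e | e ∈ G.edgeSet ∧ ∃ u v : V, e = s(u, v) ∧ u ∈ A ∧ v ∉ A}

/-- A real cut is given by a finite vertex set `A` with at least two elements; its size is the
number of edges between `A` and its complement. -/
def HasRealCutOfSize {V : Type*} (G : SimpleGraph V) (n : ℕ) : Prop :=
  ∃ A : Set V, A.Finite ∧ 2 ≤ A.ncard ∧ (cutEdges G A).encard = n

/-- `G` is vertex-transitive: its automorphism group acts transitively on the vertices. -/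
def IsVertexTransitive {V : Type*} (G : SimpleGraph V) : Prop :=
  ∀ x y : V, ∃ φ : G ≃g G, φ x = y

/-- `M` is a perfect matching of `G`: a set of edges of `G` such that every vertex lies in exactly
one edge of `M`. -/
def IsPerfectMatching {V : Type*} (G : SimpleGraph V) (M : Set (Sym2 V)) : Prop :=
  M ⊆ G.edgeSet ∧ ∀ v : V, ∃! e, e ∈ M ∧ v ∈ e

/-- `M` is mapped onto itself by every automorphism of `G`. -/
def IsAutInvariant {V : Type*} (G : SimpleGraph V) (M : Set (Sym2 V)) : Prop :=
  ∀ φ : G ≃g G, Sym2.map φ '' M = M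

/-- The edges `vw` of `G` that leave, at `v`, a `d`-clique containing `v`. -/
def cliqueLeavingEdges {V : Type*} (G : SimpleGraph V) (d : ℕ) : Set (Sym2 V) :=
  {e | ∃ (K : Finset V) (v w : V),
    G.IsNClique d K ∧ v ∈ K ∧ G.Adj v w ∧ w ∉ K ∧ e = s(v, w)}

end PaperPM

namespace PaperPM

open Finset
open scoped Classical in
/-- The neighbours of `v` inside the finite set `A`. -/
noncomputable def nbrsIn {V : Type*} (G : SimpleGraph V) (A : Finset V) (v : V) : Finset V :=
  {w ∈ A | G.Adj v w}

variable {V : Type*} {G : SimpleGraph V}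

theorem mk_mem_cutEdges {A : Set V} {x y : V} :
    s(x, y) ∈ cutEdges G A ↔ G.Adj x y ∧ ((x ∈ A ∧ y ∉ A) ∨ (y ∈ A ∧ x ∉ A)) := by
  simp only [cutEdges, Set.mem_ofPred_eq, SimpleGraph.mem_edgeSet]
  refine and_congr_right fun _ => ⟨?_, ?_⟩
  · rintro ⟨u, v, h, hu, hv⟩
    rcases Sym2.eq_iff.1 h with ⟨rfl, rfl⟩ | ⟨rfl, rfl⟩
    · exact Or.inl ⟨hu, hv⟩
    · exact Or.inr ⟨hu, hv⟩
  · rintro (⟨h1, h2⟩ | ⟨h1, h2⟩)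
    · exact ⟨x, y, rfl, h1, h2⟩
    · exact ⟨y, x, Sym2.eq_swap, h1, h2⟩

theorem ncard_add_ncard_le_of_union_of_inter {α : Type*} {s t u v : Set α}
    (hu : u.Finite) (hv : v.Finite) (h₁ : s ∪ t ⊆ u ∪ v) (h₂ : s ∩ t ⊆ u ∩ v) :
    s.ncard + t.ncard ≤ u.ncard + v.ncard := by
  have hst : (s ∪ t).Finite := (hu.union hv).subset h₁
  rw [← Set.ncard_union_add_ncard_inter s t (hst.subset Set.subset_union_left)
      (hst.subset Set.subset_union_right), ← Set.ncard_union_add_ncard_inter u v hu hv]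
  exact Nat.add_le_add (Set.ncard_le_ncard h₁ (hu.union hv))
    (Set.ncard_le_ncard h₂ (hu.inter_of_left v))

theorem ncard_cutEdges_inter_add_union_le {A B : Set V} (hA : (cutEdges G A).Finite)
    (hB : (cutEdges G B).Finite) :
    (cutEdges G (A ∩ B)).ncard + (cutEdges G (A ∪ B)).ncard ≤
      (cutEdges G A).ncard + (cutEdges G B).ncard := by
  refine ncard_add_ncard_le_of_union_of_inter hA hB ?_ ?_ <;>
  · intro e
    induction e with | _ x y =>
    simp only [Set.mem_union, Set.mem_inter_iff, mk_mem_cutEdges]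
    tauto

theorem ncard_cutEdges_sdiff_add_sdiff_le {A B : Set V} (hA : (cutEdges G A).Finite)
    (hB : (cutEdges G B).Finite) :
    (cutEdges G (A \ B)).ncard + (cutEdges G (B \ A)).ncard ≤
      (cutEdges G A).ncard + (cutEdges G B).ncard := by
  refine ncard_add_ncard_le_of_union_of_inter hA hB ?_ ?_ <;>
  · intro e
    induction e with | _ x y =>
    simp only [Set.mem_union, Set.mem_inter_iff, Set.mem_sdiff, mk_mem_cutEdges]
    tauto

open scoped Classical in
theorem cutEdges_eq_image [G.LocallyFinite] (A : Finset V) :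
    cutEdges G (A : Set V) =
      ((A.sigma fun v => G.neighborFinset v \ A).image fun p => s(p.1, p.2) : Finset (Sym2 V)) := by
  ext e
  induction e with | _ x y =>
  rw [mk_mem_cutEdges]
  simp only [mem_coe, Finset.mem_image, mem_sigma, mem_sdiff, SimpleGraph.mem_neighborFinset,
    Sigma.exists, Sym2.eq_iff]
  constructor
  · rintro ⟨h, ⟨h1, h2⟩ | ⟨h1, h2⟩⟩
    · exact ⟨x, y, ⟨h1, h, h2⟩, Or.inl ⟨rfl, rfl⟩⟩
    · exact ⟨y, x, ⟨h1, h.symm, h2⟩, Or.inr ⟨rfl, rfl⟩⟩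
  · rintro ⟨u, v, ⟨h1, h, h2⟩, ⟨rfl, rfl⟩ | ⟨rfl, rfl⟩⟩
    · exact ⟨h, Or.inl ⟨h1, h2⟩⟩
    · exact ⟨h.symm, Or.inr ⟨h1, h2⟩⟩

theorem finite_cutEdges [G.LocallyFinite] (A : Finset V) : (cutEdges G (A : Set V)).Finite := by
  classical
  rw [cutEdges_eq_image]
  exact Finset.finite_toSet _

open scoped Classical in
theorem ncard_cutEdges [G.LocallyFinite] (A : Finset V) :
    (cutEdges G (A : Set V)).ncard = ∑ v ∈ A, (G.neighborFinset v \ A).card := by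
  rw [cutEdges_eq_image, Set.ncard_coe_finset, Finset.card_image_of_injOn, card_sigma]
  rintro ⟨a, b⟩ h ⟨a', b'⟩ h' e
  simp only [mem_coe, mem_sigma, mem_sdiff] at h h'
  rcases Sym2.eq_iff.1 e with ⟨h1, h2⟩ | ⟨h1, h2⟩ <;> simp only at h1 h2
  · subst h1 h2; rfl
  · subst h1 h2; exact absurd h.1 h'.2.2

open scoped Classical in
theorem card_neighborFinset_sdiff_add [G.LocallyFinite] {d : ℕ} (hreg : G.IsRegularOfDegree d)
    (A : Finset V) (v : V) : (G.neighborFinset v \ A).card + (nbrsIn G A v).card = d := by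
  rw [← hreg v, ← SimpleGraph.card_neighborFinset_eq_degree,
    ← Finset.card_sdiff_add_card_inter (G.neighborFinset v) A]
  congr 2
  ext w
  simp [nbrsIn, and_comm]

theorem ncard_cutEdges_of_regular [G.LocallyFinite] {d r : ℕ} (hreg : G.IsRegularOfDegree d)
    {A : Finset V} (hr : ∀ v ∈ A, (nbrsIn G A v).card = r) :
    (cutEdges G (A : Set V)).ncard = A.card * (d - r) := by
  classical
  rw [ncard_cutEdges, sum_const_nat]
  intro v hv
  have := card_neighborFinset_sdiff_add hreg A v
  have := hr v hv
  omega

theorem nbrsIn_ssubset {A : Finset V} {v : V} (hv : v ∈ A) : nbrsIn G A v ⊂ A := by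
  classical
  rw [nbrsIn, Finset.filter_ssubset]
  exact ⟨v, hv, G.loopless.irrefl v⟩

theorem cutEdges_image (φ : G ≃g G) (A : Set V) :
    cutEdges G (φ '' A) = Sym2.map φ '' cutEdges G A := by
  have key : ∀ x, x ∈ φ '' A ↔ φ.symm x ∈ A := fun x => by
    constructor
    · rintro ⟨y, hy, rfl⟩; simpa using hy
    · intro h; exact ⟨_, h, by simp⟩
  have hadj : ∀ x y, G.Adj (φ.symm x) (φ.symm y) ↔ G.Adj x y := fun x y => φ.symm.map_adj_iff
  ext e
  induction e with | _ x y =>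
  rw [mk_mem_cutEdges, key, key]
  constructor
  · rintro h
    exact ⟨s(φ.symm x, φ.symm y), mk_mem_cutEdges.2 (by rwa [hadj]), by simp⟩
  · rintro ⟨e, he, hxy⟩
    induction e with | _ u v =>
    rw [mk_mem_cutEdges] at he
    rcases Sym2.eq_iff.1 hxy with ⟨rfl, rfl⟩ | ⟨rfl, rfl⟩
    · simpa [φ.map_adj_iff] using he
    · simpa [φ.map_adj_iff, G.adj_comm, or_comm] using he

theorem ncard_cutEdges_map (φ : G ≃g G) (A : Finset V) :
    (cutEdges G (A.map φ.toEquiv.toEmbedding : Set V)).ncard =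
      (cutEdges G (A : Set V)).ncard := by
  rw [Finset.coe_map]
  exact (congrArg Set.ncard (cutEdges_image φ A)).trans
    (Set.ncard_image_of_injective _ (Sym2.map.injective φ.injective))

theorem nbrsIn_map (φ : G ≃g G) (A : Finset V) (v : V) :
    nbrsIn G (A.map φ.toEquiv.toEmbedding) (φ v) =
      (nbrsIn G A v).map φ.toEquiv.toEmbedding := by
  ext w
  simp only [nbrsIn, mem_filter, Finset.mem_map]
  constructor
  · rintro ⟨⟨u, hu, rfl⟩, h⟩
    exact ⟨u, ⟨hu, φ.map_adj_iff.1 h⟩, rfl⟩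
  · rintro ⟨u, ⟨hu, h⟩, rfl⟩
    exact ⟨⟨u, hu, rfl⟩, φ.map_adj_iff.2 h⟩

/-- A block for the automorphism group of a vertex-transitive graph induces a regular graph. -/
theorem exists_card_nbrsIn_eq_of_block (htrans : IsVertexTransitive G) {A : Finset V}
    (hne : A.Nonempty)
    (hblock : ∀ φ : G ≃g G, ∀ x ∈ A, φ x ∈ A → A.map φ.toEquiv.toEmbedding = A) :
    ∃ r, ∀ v ∈ A, (nbrsIn G A v).card = r := by
  obtain ⟨x, hx⟩ := hne
  refine ⟨(nbrsIn G A x).card, fun v hv => ?_⟩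
  obtain ⟨φ, rfl⟩ := htrans x v
  conv_lhs => rw [← hblock φ x hx hv]
  rw [nbrsIn_map, card_map]

/-- In an infinite connected graph every nonempty finite vertex set has a boundary edge. -/
theorem ncard_cutEdges_pos [Infinite V] [G.LocallyFinite] (hconn : G.Connected) {A : Finset V}
    (hne : A.Nonempty) : 0 < (cutEdges G (A : Set V)).ncard := by
  obtain ⟨x, hx⟩ := hne
  obtain ⟨y, hy⟩ := Infinite.exists_notMem_finset A
  obtain ⟨p⟩ := hconn.preconnected x y
  obtain ⟨e, -, h1, h2⟩ := p.exists_boundary_dart (A : Set V) hx hy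
  exact (Set.ncard_pos (finite_cutEdges A)).2
    ⟨s(e.fst, e.snd), mk_mem_cutEdges.2 ⟨e.adj, Or.inl ⟨h1, h2⟩⟩⟩

/-- Every nonempty finite vertex set has at least `d` boundary edges. -/
theorem le_ncard_cutEdges [Infinite V] [G.LocallyFinite] {d : ℕ} (hconn : G.Connected)
    (hreg : G.IsRegularOfDegree d) (htrans : IsVertexTransitive G) {C : Finset V}
    (hC : C.Nonempty) : d ≤ (cutEdges G (C : Set V)).ncard := by
  classical
  let c : Finset V → ℕ := fun A => (cutEdges G (A : Set V)).ncard
  obtain ⟨M, hM, hMmin⟩ := exists_minimalFor_of_wellFoundedLT Finset.Nonempty c ⟨C, hC⟩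
  have hle : ∀ A : Finset V, A.Nonempty → c M ≤ c A := fun A hA =>
    (le_total (c M) (c A)).elim id fun h => hMmin hA h
  obtain ⟨A, ⟨hA, hAM⟩, hAmin⟩ := exists_minimalFor_of_wellFoundedLT
    (fun A : Finset V => A.Nonempty ∧ c A = c M) Finset.card ⟨M, hM, rfl⟩
  obtain ⟨r, hr⟩ := exists_card_nbrsIn_eq_of_block htrans hA fun φ x hx hφx => by
    set B := A.map φ.toEquiv.toEmbedding with hBdef
    have hcard : B.card = A.card := card_map _
    have hxB : φ x ∈ B := mem_map_of_mem φ.toEquiv.toEmbedding hx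
    have hB : c B = c M := (ncard_cutEdges_map φ A).trans hAM
    have hsub : c (A ∩ B) + c (A ∪ B) ≤ c A + c B := by
      simpa only [c, coe_inter, coe_union] using
        ncard_cutEdges_inter_add_union_le (finite_cutEdges A) (finite_cutEdges B)
    have hI : (A ∩ B).Nonempty := ⟨φ x, mem_inter.2 ⟨hφx, hxB⟩⟩
    have h1 := hle _ hI
    have h2 := hle (A ∪ B) (hA.mono subset_union_left)
    have h3 : A.card ≤ (A ∩ B).card :=
      hAmin ⟨hI, by omega⟩ (card_le_card inter_subset_left)
    have h4 : A ∩ B = A := eq_of_subset_of_card_le inter_subset_left h3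
    exact (eq_of_subset_of_card_le (inter_eq_left.1 h4) hcard.le).symm
  refine le_trans ?_ (hle C hC)
  have hcut : c A = A.card * (d - r) := ncard_cutEdges_of_regular hreg hr
  have hpos : 0 < c A := ncard_cutEdges_pos hconn hA
  obtain ⟨x, hx⟩ := hA
  have hlt : r < A.card := hr x hx ▸ card_lt_card (nbrsIn_ssubset hx)
  rw [← hAM, hcut]
  rw [hcut] at hpos
  obtain ⟨k, hk⟩ : ∃ k, d - r = k + 1 := ⟨d - r - 1, by have := Nat.pos_of_mul_pos_left hpos; omega⟩
  rw [hk]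
  have : (r + 1) * (k + 1) ≤ A.card * (k + 1) := Nat.mul_le_mul_right _ hlt
  have hdk : d = r + k + 1 := by omega
  nlinarith [Nat.zero_le (r * k)]

theorem card_nbrsIn_of_isNClique {d : ℕ} {K : Finset V} (hK : G.IsNClique d K) {v : V}
    (hv : v ∈ K) : (nbrsIn G K v).card = d - 1 := by
  classical
  rw [← hK.card_eq, ← card_erase_of_mem hv]
  congr 1
  ext w
  simp only [nbrsIn, mem_filter, mem_erase]
  exact ⟨fun h => ⟨h.2.ne', h.1⟩, fun h => ⟨h.2, hK.isClique hv h.2 h.1.symm⟩⟩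

theorem isNClique_of_card_nbrsIn {d : ℕ} {K : Finset V} (hcard : K.card = d)
    (h : ∀ v ∈ K, (nbrsIn G K v).card = d - 1) : G.IsNClique d K := by
  classical
  refine ⟨fun v hv w hw hvw => ?_, hcard⟩
  have hsub : nbrsIn G K v ⊆ K.erase v := fun u hu => by
    simp only [nbrsIn, mem_filter] at hu
    exact mem_erase.2 ⟨hu.2.ne', hu.1⟩
  have heq := eq_of_subset_of_card_le hsub (by rw [card_erase_of_mem hv, h v hv, hcard])
  have : w ∈ nbrsIn G K v := heq ▸ mem_erase.2 ⟨hvw.symm, hw⟩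
  exact (mem_filter.1 this).2

theorem ncard_cutEdges_of_isNClique [G.LocallyFinite] {d : ℕ} (hd : 1 ≤ d)
    (hreg : G.IsRegularOfDegree d) {K : Finset V} (hK : G.IsNClique d K) :
    (cutEdges G (K : Set V)).ncard = d := by
  rw [ncard_cutEdges_of_regular hreg fun v hv => card_nbrsIn_of_isNClique hK hv, hK.card_eq,
    Nat.sub_sub_self hd, mul_one]

/-- A real cut with `d` boundary edges has more than two vertices. -/
theorem card_ne_two_of_ncard_cutEdges [G.LocallyFinite] {d : ℕ} (hd : 3 ≤ d)
    (hreg : G.IsRegularOfDegree d) {A : Finset V}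
    (hcut : (cutEdges G (A : Set V)).ncard = d) : A.card ≠ 2 := by
  classical
  intro h2
  have hle : ∀ v ∈ A, d - 1 ≤ (G.neighborFinset v \ A).card := fun v hv => by
    have h := card_neighborFinset_sdiff_add hreg A v
    have h' : (nbrsIn G A v).card < A.card := card_lt_card (nbrsIn_ssubset hv)
    omega
  have := card_nsmul_le_sum A _ _ hle
  rw [← ncard_cutEdges, hcut, h2, smul_eq_mul] at this
  omega

section Atoms

variable [Infinite V] [G.LocallyFinite] {d : ℕ}

/-- Two real cuts with `d` boundary edges, of least cardinality among such cuts, are equal as soon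
as they meet. -/
theorem eq_of_minimal_of_mem (hd : 3 ≤ d) (hconn : G.Connected)
    (hreg : G.IsRegularOfDegree d) (htrans : IsVertexTransitive G) {A B : Finset V}
    (hA : (cutEdges G (A : Set V)).ncard = d) (hA2 : 2 ≤ A.card)
    (hB : (cutEdges G (B : Set V)).ncard = d) (hcard : B.card = A.card)
    (hmin : ∀ C : Finset V, 2 ≤ C.card → (cutEdges G (C : Set V)).ncard = d → A.card ≤ C.card)
    {x : V} (hxA : x ∈ A) (hxB : x ∈ B) : A = B := by
  classical
  have hle : ∀ C : Finset V, C.Nonempty → d ≤ (cutEdges G (C : Set V)).ncard := fun C hC =>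
    le_ncard_cutEdges hconn hreg htrans hC
  have hsub := ncard_cutEdges_inter_add_union_le (finite_cutEdges (G := G) A) (finite_cutEdges B)
  have hdiff := ncard_cutEdges_sdiff_add_sdiff_le (finite_cutEdges (G := G) A) (finite_cutEdges B)
  rw [← coe_inter, ← coe_union] at hsub
  rw [← coe_sdiff, ← coe_sdiff] at hdiff
  have hI : (A ∩ B).Nonempty := ⟨x, mem_inter.2 ⟨hxA, hxB⟩⟩
  have h1 := hle _ hI
  have h2 := hle (A ∪ B) ⟨x, mem_union_left _ hxA⟩
  by_cases hI2 : 2 ≤ (A ∩ B).card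
  · have h3 := hmin _ hI2 (by omega)
    have h4 : A ∩ B = A := eq_of_subset_of_card_le inter_subset_left h3
    exact eq_of_subset_of_card_le (inter_eq_left.1 h4) hcard.le
  · exfalso
    have hI0 := hI.card_pos
    have hAB := card_sdiff_add_card_inter A B
    have hBA := card_sdiff_add_card_inter B A
    rw [inter_comm B A] at hBA
    have h3 := hle (A \ B) (card_pos.1 (by omega))
    have h4 := hle (B \ A) (card_pos.1 (by omega))
    have hne := card_ne_two_of_ncard_cutEdges hd hreg hA
    have := hmin (A \ B) (by omega) (by omega)
    omega

/-- The least cardinality of a real cut with `d` boundary edges is `d`, and it is attained by a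
`d`-clique. -/
theorem exists_isNClique_minimal (hd : 3 ≤ d) (hconn : G.Connected)
    (hreg : G.IsRegularOfDegree d) (htrans : IsVertexTransitive G)
    (hcut : HasRealCutOfSize G d) :
    ∃ K : Finset V, G.IsNClique d K ∧
      ∀ C : Finset V, 2 ≤ C.card → (cutEdges G (C : Set V)).ncard = d → d ≤ C.card := by
  obtain ⟨S, hSfin, hS2, hScut⟩ := hcut
  lift S to Finset V using hSfin
  rw [Set.ncard_coe_finset] at hS2
  have hScut' : (cutEdges G (S : Set V)).ncard = d := by
    rw [Set.ncard_def, hScut, ENat.toNat_natCast]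
  obtain ⟨A, ⟨hA2, hAcut⟩, hAmin⟩ := exists_minimalFor_of_wellFoundedLT
    (fun A : Finset V => 2 ≤ A.card ∧ (cutEdges G (A : Set V)).ncard = d) Finset.card
    ⟨S, hS2, hScut'⟩
  have hmin : ∀ C : Finset V, 2 ≤ C.card → (cutEdges G (C : Set V)).ncard = d →
      A.card ≤ C.card := fun C h1 h2 =>
    (le_total A.card C.card).elim id fun h => hAmin ⟨h1, h2⟩ h
  have hne : A.Nonempty := card_pos.1 (by omega)
  obtain ⟨r, hr⟩ := exists_card_nbrsIn_eq_of_block htrans hne fun φ x hx hφx =>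
    (eq_of_minimal_of_mem hd hconn hreg htrans hAcut hA2
      ((ncard_cutEdges_map φ A).trans hAcut) (card_map _) hmin hφx
      (mem_map_of_mem φ.toEquiv.toEmbedding hx)).symm
  have hc := ncard_cutEdges_of_regular hreg hr
  rw [hAcut] at hc
  obtain ⟨x, hx⟩ := hne
  have hlt : r < A.card := hr x hx ▸ card_lt_card (nbrsIn_ssubset hx)
  have hrd : d - r = 1 ∧ A.card = d := by
    obtain ⟨k, hk⟩ : ∃ k, d - r = k + 1 := ⟨d - r - 1, by
      rcases Nat.eq_zero_or_pos (d - r) with h | h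
      · rw [h] at hc; omega
      · omega⟩
    rw [hk] at hc ⊢
    have hdk : d = r + k + 1 := by omega
    have h1 : (r + 1) * (k + 1) ≤ A.card * (k + 1) := Nat.mul_le_mul_right _ hlt
    have hrk : r * k = 0 := by nlinarith
    rcases Nat.mul_eq_zero.1 hrk with rfl | rfl
    · have h2 : 2 * (k + 1) ≤ A.card * (k + 1) := Nat.mul_le_mul_right _ hA2
      omega
    · exact ⟨rfl, by omega⟩
  refine ⟨A, isNClique_of_card_nbrsIn hrd.2 fun v hv => ?_, fun C h1 h2 => hrd.2 ▸ hmin C h1 h2⟩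
  rw [hr v hv]
  omega

end Atoms

theorem IsNClique.map_iso {d : ℕ} {K : Finset V} (hK : G.IsNClique d K) (φ : G ≃g G) :
    G.IsNClique d (K.map φ.toEquiv.toEmbedding) := by
  refine ⟨?_, (card_map _).trans hK.card_eq⟩
  rw [coe_map]
  rintro _ ⟨x, hx, rfl⟩ _ ⟨y, hy, rfl⟩ hxy
  exact φ.map_adj_iff.2 (hK.isClique hx hy fun h => hxy (h ▸ rfl))

theorem map_mem_cliqueLeavingEdges {d : ℕ} (φ : G ≃g G) {e : Sym2 V}
    (he : e ∈ cliqueLeavingEdges G d) : Sym2.map φ e ∈ cliqueLeavingEdges G d := by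
  obtain ⟨K, v, w, hK, hv, hvw, hw, rfl⟩ := he
  refine ⟨K.map φ.toEquiv.toEmbedding, φ v, φ w, IsNClique.map_iso hK φ,
    mem_map_of_mem φ.toEquiv.toEmbedding hv, φ.map_adj_iff.2 hvw, fun h => hw ?_, rfl⟩
  exact (mem_map' φ.toEquiv.toEmbedding).1 h

theorem isAutInvariant_cliqueLeavingEdges (G : SimpleGraph V) (d : ℕ) :
    IsAutInvariant G (cliqueLeavingEdges G d) := by
  intro φ
  refine Set.Subset.antisymm ?_ fun e he => ?_
  · rintro _ ⟨e, he, rfl⟩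
    exact map_mem_cliqueLeavingEdges φ he
  · refine ⟨_, map_mem_cliqueLeavingEdges φ.symm he, ?_⟩
    induction e with | _ x y => simp

/-- A vertex of a `d`-clique in a `d`-regular graph has a unique neighbour outside the clique. -/
theorem existsUnique_adj_notMem_of_isNClique [G.LocallyFinite] {d : ℕ} (hd : 1 ≤ d)
    (hreg : G.IsRegularOfDegree d) {K : Finset V} (hK : G.IsNClique d K) {v : V} (hv : v ∈ K) :
    ∃! w, G.Adj v w ∧ w ∉ K := by
  classical
  have h := card_neighborFinset_sdiff_add hreg K v
  rw [card_nbrsIn_of_isNClique hK hv] at h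
  obtain ⟨w, hw⟩ := card_eq_one.1 (show (G.neighborFinset v \ K).card = 1 by omega)
  have hiff : ∀ u, G.Adj v u ∧ u ∉ K ↔ u = w := fun u => by
    rw [← mem_singleton, ← hw, mem_sdiff, SimpleGraph.mem_neighborFinset]
  exact ⟨w, (hiff w).2 rfl, fun u hu => (hiff u).1 hu⟩

theorem isPerfectMatching_cliqueLeavingEdges {d : ℕ}
    (huniq : ∀ v : V, ∃! K : Finset V, G.IsNClique d K ∧ v ∈ K)
    (hleave : ∀ (v : V) (K : Finset V), G.IsNClique d K → v ∈ K → ∃! w : V, G.Adj v w ∧ w ∉ K) :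
    IsPerfectMatching G (cliqueLeavingEdges G d) := by
  refine ⟨?_, fun v => ?_⟩
  · rintro _ ⟨K, v, w, -, -, h, -, rfl⟩
    exact h
  obtain ⟨K, ⟨hK, hvK⟩, hKu⟩ := huniq v
  obtain ⟨w, ⟨hvw, hw⟩, hwu⟩ := hleave v K hK hvK
  refine ⟨s(v, w), ⟨⟨K, v, w, hK, hvK, hvw, hw, rfl⟩, Sym2.mem_mk_left v w⟩, ?_⟩
  rintro _ ⟨⟨L, a, b, hL, ha, hab, hb, rfl⟩, hv⟩
  rcases Sym2.mem_iff.1 hv with rfl | rfl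
  · obtain rfl := hKu L ⟨hL, ha⟩
    rw [hwu b ⟨hab, hb⟩]
  · have haK : a ∉ K := fun haK =>
      hb ((huniq a).unique ⟨hL, ha⟩ ⟨hK, haK⟩ ▸ hvK)
    rw [← hwu a ⟨hab.symm, haK⟩, Sym2.eq_swap]

theorem existsUnique_isNClique [Infinite V] [G.LocallyFinite] {d : ℕ} (hd : 3 ≤ d)
    (hconn : G.Connected) (hreg : G.IsRegularOfDegree d) (htrans : IsVertexTransitive G)
    (hcut : HasRealCutOfSize G d) (v : V) : ∃! K : Finset V, G.IsNClique d K ∧ v ∈ K := by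
  obtain ⟨K, hK, hmin⟩ := exists_isNClique_minimal hd hconn hreg htrans hcut
  obtain ⟨x, hx⟩ : K.Nonempty := card_pos.1 (by have := hK.card_eq; omega)
  obtain ⟨φ, rfl⟩ := htrans x v
  have hcutK : ∀ L : Finset V, G.IsNClique d L → (cutEdges G (L : Set V)).ncard = d :=
    fun L hL => ncard_cutEdges_of_isNClique (by omega) hreg hL
  refine ⟨K.map φ.toEquiv.toEmbedding,
    ⟨IsNClique.map_iso hK φ, mem_map_of_mem φ.toEquiv.toEmbedding hx⟩, fun L hL => ?_⟩
  have hφK := IsNClique.map_iso hK φ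
  exact eq_of_minimal_of_mem hd hconn hreg htrans (hcutK L hL.1) (by rw [hL.1.card_eq]; omega)
    (hcutK _ hφK) (by rw [hφK.card_eq, hL.1.card_eq])
    (by rw [hL.1.card_eq]; exact hmin) hL.2 (mem_map_of_mem φ.toEquiv.toEmbedding hx)

end PaperPM

/-- Let `d ≥ 3` and let `G` be an infinite, connected, `d`-regular, vertex-transitive graph having
a real cut of size exactly `d`. Then every vertex lies in a unique `d`-clique, exactly one edge at
each vertex leaves its `d`-clique, and these edges form a perfect matching of `G` that is invariant
under every automorphism of `G`. -/
theorem invariant_matching_of_small_real_cut {V : Type*} [Infinite V]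
    (G : SimpleGraph V) [G.LocallyFinite] (d : ℕ) (hd : 3 ≤ d)
    (hconn : G.Connected) (hreg : G.IsRegularOfDegree d)
    (htrans : PaperPM.IsVertexTransitive G)
    (hcut : PaperPM.HasRealCutOfSize G d) :
    (∀ v : V, ∃! K : Finset V, G.IsNClique d K ∧ v ∈ K) ∧
    (∀ (v : V) (K : Finset V), G.IsNClique d K → v ∈ K → ∃! w : V, G.Adj v w ∧ w ∉ K) ∧
    PaperPM.IsPerfectMatching G (PaperPM.cliqueLeavingEdges G d) ∧
    PaperPM.IsAutInvariant G (PaperPM.cliqueLeavingEdges G d) := by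
  have huniq := PaperPM.existsUnique_isNClique hd hconn hreg htrans hcut
  have hleave : ∀ (v : V) (K : Finset V), G.IsNClique d K → v ∈ K → ∃! w : V, G.Adj v w ∧ w ∉ K :=
    fun _ _ hK hv => PaperPM.existsUnique_adj_notMem_of_isNClique (by omega) hreg hK hv
  exact ⟨huniq, hleave, PaperPM.isPerfectMatching_cliqueLeavingEdges huniq hleave,
    PaperPM.isAutInvariant_cliqueLeavingEdges G d⟩
end

section
/- Let $\Gamma$ be an infinite group generated by a finite symmetric set $S$ with $1 \notin S$, and let $G$ be the Cayley graph of $(\Gamma, S)$, i.e. the simple graph with vertex set $\Gamma$ in which $g$ and $gs$ are adjacent for all $g \in \Gamma$, $s \in S$; let $E(G)$ be its edge set. Then there exists a probability measure $\nu$ on $\{0,1\}^{E(G)}$ (with the product $\sigma$-algebra) that is invariant under the natural action of $\Gamma$, $(g\cdot\omega)(\{u,v\}) = \omega(\{g^{-1}u, g^{-1}v\})$, and such that $\nu$-almost every $\omega \in \{0,1\}^{E(G)}$ is the indicator of a perfect matching of $G$, i.e. of a set of edges such that every vertex of $G$ lies in exactly one of them. -/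
namespace CayleyMatching

open SimpleGraph

/-- Left multiplication by `g` maps edges of the Cayley graph to edges. -/
theorem map_mem_edgeSet {Γ : Type*} [Group Γ] (S : Set Γ) (g : Γ) (e : Sym2 Γ)
    (he : e ∈ (mulCayley S).edgeSet) :
    Sym2.map (fun v => g * v) e ∈ (mulCayley S).edgeSet := by
  induction e using Sym2.ind with
  | _ a b =>
    rw [SimpleGraph.mem_edgeSet] at he
    simpa [SimpleGraph.mem_edgeSet, mulCayley_adj', mul_assoc] using he

/-- The action of `g ∈ Γ` on the edges of the Cayley graph induced by left multiplication
on the vertices: `{u, v} ↦ {g u, g v}`. -/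
def edgeShift {Γ : Type*} [Group Γ] (S : Set Γ) (g : Γ)
    (e : (mulCayley S).edgeSet) : (mulCayley S).edgeSet :=
  ⟨Sym2.map (fun v => g * v) e.1, map_mem_edgeSet S g e.1 e.2⟩

/-- The action of `g ∈ Γ` on `{0,1}^E`: `(g · ω)({u, v}) = ω({g⁻¹ u, g⁻¹ v})`. -/
def configShift {Γ : Type*} [Group Γ] (S : Set Γ) (g : Γ)
    (ω : (mulCayley S).edgeSet → Bool) : (mulCayley S).edgeSet → Bool :=
  fun e => ω (edgeShift S g⁻¹ e)

/-- `M` is a perfect matching of `G`: a set of edges of `G` such that every vertex lies in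
exactly one of them. -/
def IsPerfectMatching {V : Type*} (G : SimpleGraph V) (M : Set G.edgeSet) : Prop :=
  ∀ v : V, ∃! e : G.edgeSet, e ∈ M ∧ v ∈ e.1

end CayleyMatching

namespace CayleyMatching

open SimpleGraph Finset

section Combinatorics

variable {V : Type*} {G : SimpleGraph V} {f g h : V → V}

/-- A matching of `G` encoded as an involution: matched vertices are sent to their partner,
unmatched vertices are fixed. -/
structure IsMatchingMap (G : SimpleGraph V) (f : V → V) : Prop where
  invol : ∀ v, f (f v) = v
  adj : ∀ v, f v = v ∨ G.Adj v (f v)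

open Classical in
/-- The number of vertices of `F` left unmatched by `f`. -/
noncomputable def defect (f : V → V) (F : Finset V) : ℕ := #{v ∈ F | f v = v}

/-- No finite modification of the matching `f` decreases the number of unmatched vertices. -/
structure IsLocMax (G : SimpleGraph V) (f : V → V) : Prop extends IsMatchingMap G f where
  le_defect : ∀ g, IsMatchingMap G g → ∀ F : Finset V, (∀ v ∉ F, f v = g v) →
    defect f F ≤ defect g F

/-- `g` is a matching obtained from `f` by a finite modification that preserves the number of
unmatched vertices. -/
def LocEquiv (G : SimpleGraph V) (f g : V → V) : Prop :=
  IsMatchingMap G g ∧ ∃ F : Finset V, (∀ v ∉ F, f v = g v) ∧ defect f F = defect g F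

/-- The vertices left unmatched by some matching equivalent to `f`. -/
def inessential (G : SimpleGraph V) (f : V → V) : Set V := {v | ∃ g, LocEquiv G f g ∧ g v = v}

theorem defect_congr {F : Finset V} (h : ∀ v ∈ F, f v = g v) : defect f F = defect g F := by
  classical
  unfold defect
  congr 1
  exact Finset.filter_congr fun v hv => by rw [h v hv]

theorem defect_superset {F F' : Finset V} (hF : F ⊆ F') (h : ∀ v ∉ F, f v = g v) :
    defect f F' + defect g F = defect g F' + defect f F := by
  classical
  have key (k : V → V) : defect k F' = defect k F + defect k (F' \ F) := by
    unfold defect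
    rw [← Finset.card_union_of_disjoint]
    · rw [← Finset.filter_union, Finset.union_sdiff_of_subset hF]
    · exact Finset.disjoint_filter_filter Finset.disjoint_sdiff
  have e : defect f (F' \ F) = defect g (F' \ F) :=
    defect_congr fun v hv => h v (Finset.mem_sdiff.1 hv).2
  rw [key f, key g, e]
  ring

theorem exists_closed_superset (hf : ∀ v, f (f v) = v) (hg : ∀ v, g (g v) = v) (F : Finset V)
    (h : ∀ v ∉ F, f v = g v) :
    ∃ F', F ⊆ F' ∧ (∀ v ∈ F', f v ∈ F') ∧ ∀ v ∈ F', g v ∈ F' := by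
  classical
  have hcl : ∀ v ∈ F ∪ F.image f, f v ∈ F ∪ F.image f := by
    intro v hv
    rcases Finset.mem_union.1 hv with hv | hv
    · exact Finset.mem_union_right _ (Finset.mem_image_of_mem f hv)
    · obtain ⟨w, hw, rfl⟩ := Finset.mem_image.1 hv
      rw [hf]
      exact Finset.mem_union_left _ hw
  refine ⟨F ∪ F.image f, Finset.subset_union_left, hcl, fun v hv => ?_⟩
  by_contra hgv
  have h1 : f (g v) = v := by
    rw [h (g v) fun h' => hgv (Finset.mem_union_left _ h'), hg]
  exact hgv (by rw [← hf (g v), h1]; exact hcl v hv)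

theorem defect_modEq_card (hf : ∀ v, f (f v) = v) {F : Finset V} (hF : ∀ v ∈ F, f v ∈ F) :
    defect f F % 2 = #F % 2 := by
  classical
  have h0 : ∑ v ∈ F with ¬ f v = v, (1 : ZMod 2) = 0 := by
    refine Finset.sum_involution (fun v _ => f v) ?_ ?_ ?_ ?_
    · intros; rfl
    · intro v hv _
      exact (Finset.mem_filter.1 hv).2
    · intro v hv
      have := Finset.mem_filter.1 hv
      exact Finset.mem_filter.2 ⟨hF v this.1, fun h => this.2 (by rw [hf] at h; exact h.symm)⟩
    · intro v _
      exact hf v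
  have h1 := Finset.card_filter_add_card_filter_not (s := F) (fun v => f v = v)
  rw [Finset.sum_const, nsmul_eq_mul, mul_one, ZMod.natCast_eq_zero_iff] at h0
  unfold defect
  omega

theorem defect_parity (hf : ∀ v, f (f v) = v) (hg : ∀ v, g (g v) = v) {F : Finset V}
    (h : ∀ v ∉ F, f v = g v) : defect f F % 2 = defect g F % 2 := by
  obtain ⟨F', hFF, h1, h2⟩ := exists_closed_superset hf hg F h
  have := defect_superset hFF h
  have := defect_modEq_card hf h1
  have := defect_modEq_card hg h2
  omega

open Classical in
/-- Add the edge `uv` to a matching `f` that misses both ends. -/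
noncomputable def addEdge (f : V → V) (u v : V) : V → V :=
  fun w => if w = u then v else if w = v then u else f w

theorem addEdge_of_ne {u v w : V} (hu : w ≠ u) (hv : w ≠ v) : addEdge f u v w = f w := by
  simp [addEdge, hu, hv]

theorem IsMatchingMap.addEdge (hf : IsMatchingMap G f) {u v : V} (hu : f u = u) (hv : f v = v)
    (h : G.Adj u v) : IsMatchingMap G (addEdge f u v) := by
  have := h.symm
  have := h.ne
  constructor <;> intro w <;> have := hf.invol w <;> have := hf.adj w <;>
    unfold CayleyMatching.addEdge <;> grind

theorem defect_addEdge {u v : V} (hu : f u = u) (hv : f v = v)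
    (h : u ≠ v) {F : Finset V} (h₁ : u ∈ F) (h₂ : v ∈ F) :
    defect (addEdge f u v) F + 2 = defect f F := by
  classical
  unfold defect
  have : {w ∈ F | f w = w} = {w ∈ F | addEdge f u v w = w} ∪ {u, v} := by
    ext w
    simp only [addEdge, Finset.mem_filter, Finset.mem_union, Finset.mem_insert,
      Finset.mem_singleton]
    grind
  rw [this, Finset.card_union_of_disjoint, Finset.card_pair h]
  rw [Finset.disjoint_right]
  intro w hw
  simp only [addEdge, Finset.mem_insert, Finset.mem_singleton] at hw ⊢
  grind

theorem IsLocMax.not_adj (hf : IsLocMax G f) {u v : V} (hu : f u = u) (hv : f v = v) :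
    ¬ G.Adj u v := by
  classical
  intro hadj
  have h1 := hf.le_defect _ (hf.1.addEdge hu hv hadj) {u, v} (by
    intro w hw
    simp only [Finset.mem_insert, Finset.mem_singleton, not_or] at hw
    rw [addEdge_of_ne hw.1 hw.2])
  have h2 := defect_addEdge hu hv hadj.ne (F := {u, v}) (by simp) (by simp)
  omega

theorem LocEquiv.refl (hf : IsMatchingMap G f) : LocEquiv G f f :=
  ⟨hf, ∅, fun _ _ => rfl, rfl⟩

theorem LocEquiv.symm (hf : IsMatchingMap G f) (h : LocEquiv G f g) : LocEquiv G g f := by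
  obtain ⟨_, F, hF, hd⟩ := h
  exact ⟨hf, F, fun v hv => (hF v hv).symm, hd.symm⟩

theorem LocEquiv.trans (h₁ : LocEquiv G f g) (h₂ : LocEquiv G g h) : LocEquiv G f h := by
  classical
  obtain ⟨_, F, hF, hd⟩ := h₁
  obtain ⟨hh, F', hF', hd'⟩ := h₂
  refine ⟨hh, F ∪ F', fun v hv => ?_, ?_⟩
  · simp only [Finset.mem_union, not_or] at hv
    rw [hF v hv.1, hF' v hv.2]
  · have h1 := defect_superset (Finset.subset_union_left (s₁ := F) (s₂ := F')) hF
    have h2 := defect_superset (Finset.subset_union_right (s₁ := F) (s₂ := F')) hF'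
    omega

theorem IsLocMax.of_locEquiv (hf : IsLocMax G f) (h : LocEquiv G f g) : IsLocMax G g := by
  classical
  obtain ⟨hg, F, hF, hd⟩ := h
  refine ⟨hg, fun k hk F' hF' => ?_⟩
  have h1 := defect_superset (Finset.subset_union_left (s₁ := F) (s₂ := F')) hF
  have h2 := defect_superset (Finset.subset_union_right (s₁ := F) (s₂ := F')) hF'
  have := hf.le_defect k hk (F ∪ F') (fun v hv => by
    simp only [Finset.mem_union, not_or] at hv
    rw [hF v hv.1, hF' v hv.2])
  omega

theorem mem_inessential_of_fixed (hf : IsMatchingMap G f) {v : V} (hv : f v = v) :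
    v ∈ inessential G f := ⟨f, LocEquiv.refl hf, hv⟩

open Classical in
theorem IsMatchingMap.piecewise (hf : IsMatchingMap G f) (hg : IsMatchingMap G g) {K : Finset V}
    (hfK : ∀ v ∈ K, f v ∈ K) (hgK : ∀ v ∈ K, g v ∈ K) :
    IsMatchingMap G (K.piecewise g f) := by
  constructor
  · intro v
    by_cases hv : v ∈ K
    · simp [hv, hgK v hv, hg.invol]
    · have : f v ∉ K := fun h => hv (by simpa [hf.invol] using hfK _ h)
      simp [hv, this, hf.invol]
  · intro v
    by_cases hv : v ∈ K
    · simpa [hv] using hg.adj v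
    · simpa [hv] using hf.adj v

/-- The orbit of an unmatched vertex `b` of `g` under the group generated by `f` and `g`. -/
theorem exists_alternating_orbit (hf : IsMatchingMap G f) (hg : IsMatchingMap G g)
    {F : Finset V} (hF : ∀ v ∉ F, f v = g v) {b : V} (hb : g b = b) (hfb : f b ≠ b) :
    ∃ K : Finset V, b ∈ K ∧ (∀ v ∈ K, f v ∈ K) ∧ (∀ v ∈ K, g v ∈ K) ∧
      ((∃ t ∈ K, f t = t) → ∀ v ∈ K, g v = v → v = b) := by
  classical
  let σf : Equiv.Perm V := Function.Involutive.toPerm f hf.invol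
  let σg : Equiv.Perm V := Function.Involutive.toPerm g hg.invol
  let p : Equiv.Perm V := σg * σf
  have hinv : σg * p * σg⁻¹ = p⁻¹ := by
    ext v
    simp only [Equiv.Perm.mul_apply, p, mul_inv_rev]
    change g (g (f (σg⁻¹ v))) = σf⁻¹ (σg⁻¹ v)
    rw [hg.invol]
    rfl
  have hgp (i : ℤ) : g ((p ^ i) b) = (p ^ (-i)) b := by
    have : σg * p ^ i * σg⁻¹ = p ^ (-i) := by
      rw [← conj_zpow, hinv, inv_zpow, zpow_neg]
    rw [← this]
    simp only [Equiv.Perm.mul_apply]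
    have e : σg⁻¹ b = b := by rw [Equiv.Perm.inv_eq_iff_eq]; exact hb.symm
    rw [e]; rfl
  have hfp (i : ℤ) : f ((p ^ i) b) = (p ^ (-(i + 1))) b := by
    rw [← hgp, add_comm, zpow_add, zpow_one, Equiv.Perm.mul_apply]
    change _ = g (g (f _))
    rw [hg.invol]
  have hmem (v : V) (hv : p v ≠ v) : v ∈ F := by
    by_contra h
    apply hv
    change g (f v) = v
    rw [hF v h, hg.invol]
  have hpb : p b ≠ b := by
    change g (f b) ≠ b
    intro h
    apply hfb
    have := congrArg g h
    rwa [hg.invol, hb] at this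
  have hfin : (Set.range fun i : ℤ => (p ^ i) b) ⊆ F := by
    rintro _ ⟨i, rfl⟩
    apply hmem
    intro h
    apply hpb
    apply (p ^ i).injective
    rw [← Equiv.Perm.mul_apply, ← zpow_add_one, add_comm, zpow_one_add, Equiv.Perm.mul_apply]
    exact h
  have hfin' := F.finite_toSet.subset hfin
  have hK (v : V) : v ∈ hfin'.toFinset ↔ ∃ i : ℤ, (p ^ i) b = v := by simp
  refine ⟨hfin'.toFinset, (hK b).2 ⟨0, rfl⟩, ?_, ?_, ?_⟩
  · intro v hv
    obtain ⟨i, rfl⟩ := (hK v).1 hv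
    exact (hK _).2 ⟨_, (hfp i).symm⟩
  · intro v hv
    obtain ⟨i, rfl⟩ := (hK v).1 hv
    exact (hK _).2 ⟨_, (hgp i).symm⟩
  · rintro ⟨t, ht, hft⟩ v hv hgv
    obtain ⟨i, rfl⟩ := (hK t).1 ht
    obtain ⟨j, rfl⟩ := (hK v).1 hv
    have period (k : ℤ) : (p ^ k) b = b ↔ (MulAction.period p b : ℤ) ∣ k := by
      rw [← MulAction.zpow_smul_eq_iff_period_dvd, Equiv.Perm.smul_def]
    have eqiff (k l : ℤ) : (p ^ k) b = (p ^ l) b ↔ (MulAction.period p b : ℤ) ∣ l - k := by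
      rw [← period, sub_eq_neg_add, zpow_add, Equiv.Perm.mul_apply, zpow_neg,
        Equiv.Perm.inv_eq_iff_eq, eq_comm]
    rw [hfp, eqiff] at hft
    rw [hgp, eqiff] at hgv
    rw [period]
    obtain ⟨c, hc⟩ := hft
    obtain ⟨d, hd⟩ := hgv
    exact ⟨j * c - i * d, by linear_combination j * hc - i * hd⟩

/-- The exchange property of the sets of vertices missed by equivalent maximum matchings. -/
theorem IsLocMax.exchange (hf : IsLocMax G f) (hfg : LocEquiv G f g) {b : V} (hb : g b = b)
    (hfb : f b ≠ b) :
    ∃ h t, LocEquiv G f h ∧ h b = b ∧ ∀ v, v ≠ t → f v = v → h v = v := by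
  classical
  have hg := hf.of_locEquiv hfg
  obtain ⟨_, F, hF, _⟩ := hfg
  obtain ⟨K, hbK, hfK, hgK, hK⟩ := exists_alternating_orbit hf.1 hg.1 hF hb hfb
  have m1 := hf.1.piecewise hg.1 hfK hgK
  have m2 := hg.1.piecewise hf.1 hgK hfK
  have d1 := hf.le_defect _ m1 K (fun v hv => by simp [hv])
  have d2 := hg.le_defect _ m2 K (fun v hv => by simp [hv])
  rw [defect_congr (f := K.piecewise g f) (g := g) (fun v hv => by simp [hv])] at d1
  rw [defect_congr (f := K.piecewise f g) (g := f) (fun v hv => by simp [hv])] at d2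
  have hpos : 0 < defect g K := Finset.card_pos.2 ⟨b, by simp [hbK, hb]⟩
  have hpos' : 0 < defect f K := by omega
  obtain ⟨t, ht⟩ := Finset.card_pos.1 hpos'
  simp only [Finset.mem_filter] at ht
  have hone : defect g K = 1 := by
    refine Finset.card_eq_one.2 ⟨b, ?_⟩
    ext v
    simp only [Finset.mem_filter, Finset.mem_singleton]
    exact ⟨fun hv => hK ⟨t, ht⟩ v hv.1 hv.2, fun hv => by rw [hv]; exact ⟨hbK, hb⟩⟩
  have hle : defect f K ≤ 1 := by omega
  refine ⟨K.piecewise g f, t, ⟨m1, K, fun v hv => by simp [hv], ?_⟩, by simp [hbK, hb], ?_⟩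
  · rw [defect_congr (f := K.piecewise g f) (g := g) (fun v hv => by simp [hv])]
    omega
  · intro v hvt hv
    by_cases hvK : v ∈ K
    · exact absurd (Finset.card_le_one.1 hle v (by simp [hvK, hv]) t (by simp [ht.1, ht.2])) hvt
    · simp [hvK, hv]

/-- `u` and `v` lie in the same connected component of the inessential vertices. -/
def Linked (G : SimpleGraph V) (f : V → V) (u v : V) : Prop :=
  Relation.ReflTransGen (fun x y => G.Adj x y ∧ x ∈ inessential G f ∧ y ∈ inessential G f) u v

/-- Gallai's lemma. -/
theorem IsLocMax.eq_of_linked (hf : IsLocMax G f) {u v : V} (huv : Linked G f u v)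
    (hg : LocEquiv G f g) (hu : g u = u) (hv : g v = v) : u = v := by
  induction huv generalizing g with
  | refl => rfl
  | @tail w v huw hwv ih =>
    obtain ⟨hadj, ⟨k, hk, hkw⟩, -⟩ := hwv
    have hgm := hf.of_locEquiv hg
    by_contra hne
    by_cases hgw : g w = w
    · exact hgm.not_adj hgw hv hadj
    · obtain ⟨h, t, hh, hw, ht⟩ := hgm.exchange ((hg.symm hf.1).trans hk) hkw hgw
      by_cases hut : u = t
      · exact (hgm.of_locEquiv hh).not_adj hw (ht v (fun e => hne (hut.trans e.symm)) hv) hadj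
      · have := ih (hg.trans hh) (ht u hut hu) hw
        exact hgw (this ▸ hu)

open Classical in
/-- Remove the edge at `a` from the matching `f`. -/
noncomputable def unmatch (f : V → V) (a : V) : V → V :=
  fun v => if v = a ∨ v = f a then v else f v

/-- The graph obtained by isolating the vertex `a`. -/
def isolate (G : SimpleGraph V) (a : V) : SimpleGraph V where
  Adj u v := G.Adj u v ∧ u ≠ a ∧ v ≠ a
  symm := ⟨fun _ _ h => ⟨h.1.symm, h.2.2, h.2.1⟩⟩
  loopless := ⟨fun _ h => h.1.ne rfl⟩

theorem unmatch_of_ne {a v : V} (h₁ : v ≠ a) (h₂ : v ≠ f a) : unmatch f a v = f v := by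
  simp [unmatch, h₁, h₂]

theorem unmatch_fixed {a v : V} (h : f v = v) : unmatch f a v = v := by
  simp [unmatch, h]

theorem unmatch_apply (a : V) : unmatch f a (f a) = f a := by simp [unmatch]

theorem IsMatchingMap.unmatch (hf : IsMatchingMap G f) (a : V) :
    IsMatchingMap (isolate G a) (unmatch f a) := by
  constructor
  · intro v
    have := hf.invol v
    have := hf.invol a
    unfold CayleyMatching.unmatch
    grind
  · intro v
    have := hf.invol v
    have := hf.adj v
    unfold CayleyMatching.unmatch isolate
    grind

theorem IsMatchingMap.of_isolate {a : V} (hf : IsMatchingMap (isolate G a) f) :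
    IsMatchingMap G f := ⟨hf.1, fun v => (hf.2 v).imp id And.left⟩

theorem IsMatchingMap.isolate_fixed {a : V} (hf : IsMatchingMap (isolate G a) f) : f a = a :=
  (hf.2 a).resolve_right fun h => h.2.1 rfl

theorem defect_unmatch (hf : IsMatchingMap G f) {a : V} (ha : f a ≠ a) {F : Finset V}
    (h₁ : a ∈ F) (h₂ : f a ∈ F) : defect (unmatch f a) F = defect f F + 2 := by
  classical
  unfold defect
  have : {v ∈ F | unmatch f a v = v} = {v ∈ F | f v = v} ∪ {a, f a} := by
    ext v
    have := hf.invol a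
    simp only [unmatch, Finset.mem_filter, Finset.mem_union, Finset.mem_insert,
      Finset.mem_singleton]
    grind
  rw [this, Finset.card_union_of_disjoint, Finset.card_pair ha.symm]
  rw [Finset.disjoint_right]
  intro v hv
  have := hf.invol a
  simp only [Finset.mem_filter, Finset.mem_insert, Finset.mem_singleton] at hv ⊢
  grind

theorem IsLocMax.unmatch (hf : IsLocMax G f) {a : V} (ha : a ∉ inessential G f) :
    IsLocMax (isolate G a) (unmatch f a) := by
  classical
  have hfa : f a ≠ a := fun h => ha (mem_inessential_of_fixed hf.1 h)
  refine ⟨hf.1.unmatch a, fun g hg F hF => ?_⟩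
  set F' := F ∪ {a, f a} with hF'
  have hag : ∀ v ∉ F', f v = g v := by
    intro v hv
    simp only [hF', Finset.mem_union, Finset.mem_insert, Finset.mem_singleton, not_or] at hv
    rw [← hF v hv.1, unmatch_of_ne hv.2.1 hv.2.2]
  have h1 := defect_superset (show F ⊆ F' from Finset.subset_union_left) hF
  have h2 := hf.le_defect g hg.of_isolate F' hag
  have h3 := defect_unmatch hf.1 hfa (F := F') (by simp [hF']) (by simp [hF'])
  have hne : defect f F' ≠ defect g F' := fun h =>
    ha ⟨g, ⟨hg.of_isolate, F', hag, h⟩, hg.isolate_fixed⟩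
  have hpar := defect_parity hf.invol hg.invol hag
  omega

theorem LocEquiv.unmatch (hf : IsMatchingMap G f) (hfg : LocEquiv G f g) {a : V} (hfa : f a ≠ a)
    (hga : g a ≠ a) : LocEquiv (isolate G a) (unmatch f a) (unmatch g a) := by
  classical
  obtain ⟨hg, F, hF, hd⟩ := hfg
  refine ⟨hg.unmatch a, F ∪ {a, f a, g a}, fun v hv => ?_, ?_⟩
  · simp only [Finset.mem_union, Finset.mem_insert, Finset.mem_singleton, not_or] at hv
    rw [unmatch_of_ne hv.2.1 hv.2.2.1, unmatch_of_ne hv.2.1 hv.2.2.2, hF v hv.1]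
  · rw [defect_unmatch hf hfa (by simp) (by simp), defect_unmatch hg hga (by simp) (by simp)]
    have := defect_superset (Finset.subset_union_left (s₁ := F) (s₂ := {a, f a, g a})) hF
    omega

/-- Isolating an essential vertex keeps the inessential vertices inessential. -/
theorem IsLocMax.inessential_subset_isolate (hf : IsLocMax G f) {a : V}
    (ha : a ∉ inessential G f) :
    inessential G f ⊆ inessential (isolate G a) (CayleyMatching.unmatch f a) := by
  rintro v ⟨g, hg, hv⟩
  have hfa : f a ≠ a := fun h => ha (mem_inessential_of_fixed hf.1 h)
  have hga : g a ≠ a := fun h => ha ⟨g, hg, h⟩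
  exact ⟨_, hg.unmatch hf.1 hfa hga, unmatch_fixed hv⟩

/-- Isolating an essential neighbour of an inessential vertex creates no new inessential
vertices. -/
theorem IsLocMax.inessential_isolate_subset (hf : IsLocMax G f) {a x : V}
    (ha : a ∉ inessential G f) (hx : x ∈ inessential G f) (hax : G.Adj a x) {v : V}
    (hva : v ≠ a) (hv : v ∈ inessential (isolate G a) (CayleyMatching.unmatch f a)) :
    v ∈ inessential G f := by
  classical
  have hfa : f a ≠ a := fun h => ha (mem_inessential_of_fixed hf.1 h)
  obtain ⟨g, hg, hgx⟩ := hx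
  have hga : g a ≠ a := fun h => ha ⟨g, hg, h⟩
  have hgm := hg.1
  have hg' := hg.unmatch hf.1 hfa hga
  have hmax := (hf.unmatch ha).of_locEquiv hg'
  have hxb : x ≠ g a := by
    rintro rfl
    rw [hgm.invol] at hgx
    exact hga hgx.symm
  have hadjb : G.Adj a (g a) := (hgm.adj a).resolve_left hga
  have main : ∀ k, LocEquiv (isolate G a) (CayleyMatching.unmatch g a) k → k v = v →
      ∀ y, G.Adj a y → k y = y → v ≠ y → v ∈ inessential G f := by
    rintro k ⟨hk, F, hF, hd⟩ hkv y hay hky hvy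
    have hka := hk.isolate_fixed
    refine ⟨addEdge k a y, hg.trans ⟨hk.of_isolate.addEdge hka hky hay,
      F ∪ {a, g a, y}, ?_, ?_⟩, ?_⟩
    · intro w hw
      simp only [Finset.mem_union, Finset.mem_insert, Finset.mem_singleton, not_or] at hw
      rw [addEdge_of_ne hw.2.1 hw.2.2.2, ← hF w hw.1, unmatch_of_ne hw.2.1 hw.2.2.1]
    · have h1 := defect_superset (Finset.subset_union_left (s₁ := F) (s₂ := {a, g a, y})) hF
      have h2 := defect_unmatch hgm hga (F := F ∪ {a, g a, y}) (by simp) (by simp)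
      have h3 := defect_addEdge hka hky hay.ne (F := F ∪ {a, g a, y}) (by simp) (by simp)
      omega
    · rw [addEdge_of_ne hva hvy, hkv]
  by_cases hvx : v = x
  · exact hvx ▸ ⟨g, hg, hgx⟩
  by_cases hgv : CayleyMatching.unmatch g a v = v
  · exact main _ (LocEquiv.refl (hgm.unmatch a)) hgv x hax (unmatch_fixed hgx) hvx
  obtain ⟨k', hk', hk'v⟩ := hv
  obtain ⟨k, t, hk, hkv, ht⟩ := hmax.exchange
    ((hg'.symm (hf.unmatch ha).1).trans hk') hk'v hgv
  by_cases hxt : x = t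
  · refine main k hk hkv (g a) hadjb (ht _ (fun e => hxb (hxt.trans e.symm)) (unmatch_apply a)) ?_
    rintro rfl
    exact hgv (unmatch_apply a)
  · exact main k hk hkv x hax (ht x hxt (unmatch_fixed hgx)) hvx

/-- An essential neighbour of an inessential vertex is matched to an inessential vertex. -/
theorem IsLocMax.apply_mem_inessential (hf : IsLocMax G f) {a x : V}
    (ha : a ∉ inessential G f) (hx : x ∈ inessential G f) (hax : G.Adj a x) :
    f a ∈ inessential G f := by
  have hfa : f a ≠ a := fun h => ha (mem_inessential_of_fixed hf.1 h)
  exact hf.inessential_isolate_subset ha hx hax hfa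
    (mem_inessential_of_fixed (hf.unmatch ha).1 (unmatch_apply a))

/-- The vertices at which a component of the inessential vertices is not matched internally. -/
def IsRoot (G : SimpleGraph V) (f : V → V) (r : V) : Prop :=
  r ∈ inessential G f ∧ (f r = r ∨ f r ∉ inessential G f)

theorem Linked.isolate (hf : IsLocMax G f) {a : V} (ha : a ∉ inessential G f) {u v : V}
    (h : Linked G f u v) : Linked (isolate G a) (unmatch f a) u v := by
  refine Relation.ReflTransGen.mono (fun x y hxy => ?_) u v h
  exact ⟨⟨hxy.1, fun e => ha (e ▸ hxy.2.1), fun e => ha (e ▸ hxy.2.2)⟩,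
    hf.inessential_subset_isolate ha hxy.2.1, hf.inessential_subset_isolate ha hxy.2.2⟩

/-- Each component of the inessential vertices has at most one root. -/
theorem IsLocMax.root_unique (hf : IsLocMax G f) {r s : V} (hr : IsRoot G f r)
    (hs : IsRoot G f s) (h : Linked G f r s) : r = s := by
  have key : ∀ (G : SimpleGraph V) (f : V → V), IsLocMax G f → ∀ r s : V, f r = r →
      IsRoot G f s → Linked G f r s → r = s := by
    intro G f hf r s hr hs h
    rcases hs with ⟨hsD, hs | hs⟩
    · exact hf.eq_of_linked h (LocEquiv.refl hf.1) hr hs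
    · refine (hf.unmatch hs).eq_of_linked (h.isolate hf hs)
        (LocEquiv.refl (hf.unmatch hs).1) (unmatch_fixed hr) ?_
      have := unmatch_apply (f := f) (f s)
      rwa [hf.invol] at this
  rcases hr with ⟨hrD, hr | hr⟩
  · exact key G f hf r s hr hs h
  · by_cases hrs : r = s
    · exact hrs
    have hfr : f r ≠ r := fun e => hr (by rwa [e])
    have hadj : G.Adj (f r) r := ((hf.adj r).resolve_left hfr).symm
    refine key _ _ (hf.unmatch hr) r s ?_ ⟨hf.inessential_subset_isolate hr hs.1, ?_⟩
      (h.isolate hf hr)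
    · have := unmatch_apply (f := f) (f r)
      rwa [hf.invol] at this
    · have hsr : s ≠ f r := fun e => hr (e ▸ hs.1)
      have hsr' : s ≠ f (f r) := by rw [hf.invol]; exact fun e => hrs e.symm
      rw [unmatch_of_ne hsr hsr']
      refine hs.2.imp id fun hfs hmem => hfs ?_
      refine hf.inessential_isolate_subset hr hrD hadj ?_ hmem
      intro e
      have := congrArg f e
      rw [hf.invol, hf.invol] at this
      exact hrs this.symm

end Combinatorics

end CayleyMatching

namespace CayleyMatching

open SimpleGraph Finset

section EdgeBoundary

variable {Γ : Type*} [Group Γ]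

open Classical in
/-- The number of edges of the Cayley graph of `S` leaving the finite set `C`. -/
noncomputable def edgeBoundary (S C : Finset Γ) : ℕ := ∑ c ∈ C, #{s ∈ S | c * s ∉ C}

open Classical in
theorem edgeBoundary_eq_sum (S C W : Finset Γ) (h : C ⊆ W) :
    edgeBoundary S C = ∑ c ∈ W, ∑ s ∈ S, if c ∈ C ∧ c * s ∉ C then 1 else 0 := by
  unfold edgeBoundary
  rw [← Finset.sum_subset h]
  · refine Finset.sum_congr rfl fun c hc => ?_
    rw [Finset.card_filter]
    simp [hc]
  · intro c _ hc
    simp [hc]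

open Classical in
theorem edgeBoundary_submodular (S C C' : Finset Γ) :
    edgeBoundary S (C ∩ C') + edgeBoundary S (C ∪ C') ≤ edgeBoundary S C + edgeBoundary S C' := by
  rw [edgeBoundary_eq_sum S (C ∩ C') (C ∪ C') Finset.inter_subset_union,
    edgeBoundary_eq_sum S (C ∪ C') (C ∪ C') subset_rfl,
    edgeBoundary_eq_sum S C (C ∪ C') Finset.subset_union_left,
    edgeBoundary_eq_sum S C' (C ∪ C') Finset.subset_union_right,
    ← Finset.sum_add_distrib, ← Finset.sum_add_distrib]
  refine Finset.sum_le_sum fun c _ => ?_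
  rw [← Finset.sum_add_distrib, ← Finset.sum_add_distrib]
  refine Finset.sum_le_sum fun s _ => ?_
  simp only [Finset.mem_inter, Finset.mem_union]
  by_cases h1 : c ∈ C <;> by_cases h2 : c ∈ C' <;> by_cases h3 : c * s ∈ C <;>
    by_cases h4 : c * s ∈ C' <;> simp [h1, h2, h3, h4]

open Classical in
theorem edgeBoundary_image_mul (S C : Finset Γ) (g : Γ) :
    edgeBoundary S (C.image (g * ·)) = edgeBoundary S C := by
  unfold edgeBoundary
  rw [Finset.sum_image (mul_right_injective g).injOn]
  refine Finset.sum_congr rfl fun c _ => ?_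
  congr 1
  refine Finset.filter_congr fun s _ => ?_
  simp [mul_assoc]

theorem card_le_edgeBoundary [Infinite Γ] (S : Finset Γ) (hone : (1 : Γ) ∉ S)
    (hgen : Subgroup.closure (S : Set Γ) = ⊤) {C : Finset Γ} (hC : C.Nonempty) :
    #S ≤ edgeBoundary S C := by
  classical
  let φ : Finset Γ → ℕ ×ₗ ℕ := fun C => toLex (edgeBoundary S C, #C)
  obtain ⟨B, hB, hmin⟩ := (InvImage.wf φ wellFounded_lt).has_min {C | C.Nonempty} ⟨C, hC⟩
  have hmin1 : ∀ C : Finset Γ, C.Nonempty → edgeBoundary S B ≤ edgeBoundary S C := by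
    intro C hC
    by_contra! h
    exact hmin C hC (Prod.Lex.toLex_lt_toLex.2 (Or.inl h))
  have hmin2 : ∀ C : Finset Γ, C.Nonempty → edgeBoundary S C ≤ edgeBoundary S B → #B ≤ #C := by
    intro C hC hle
    by_contra! h
    exact hmin C hC (Prod.Lex.toLex_lt_toLex.2 (Or.inr ⟨le_antisymm hle (hmin1 C hC), h⟩))
  refine le_trans ?_ (hmin1 C hC)
  obtain ⟨b, hb⟩ := hB
  set H := B.image (b⁻¹ * ·) with hH
  have hHb : edgeBoundary S H = edgeBoundary S B := edgeBoundary_image_mul S B _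
  have hHc : #H = #B := Finset.card_image_of_injective _ (mul_right_injective _)
  have h1 : (1 : Γ) ∈ H := Finset.mem_image.2 ⟨b, hb, by simp⟩
  have hdiv : ∀ x ∈ H, ∀ y ∈ H, x⁻¹ * y ∈ H := by
    intro x hx y hy
    set H' := H.image (x⁻¹ * ·) with hH'
    have hb' : edgeBoundary S H' = edgeBoundary S B := (edgeBoundary_image_mul S H _).trans hHb
    have hc' : #H' = #B := (Finset.card_image_of_injective _ (mul_right_injective _)).trans hHc
    have h1' : (1 : Γ) ∈ H' := Finset.mem_image.2 ⟨x, hx, by simp⟩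
    have hsub := edgeBoundary_submodular S H H'
    have hi : (H ∩ H').Nonempty := ⟨1, Finset.mem_inter.2 ⟨h1, h1'⟩⟩
    have hu : (H ∪ H').Nonempty := ⟨1, Finset.mem_union_left _ h1⟩
    have := hmin1 _ hu
    have hcard := hmin2 _ hi (by omega)
    have e : H ∩ H' = H' :=
      Finset.eq_of_subset_of_card_le Finset.inter_subset_right (by omega)
    have : x⁻¹ * y ∈ H' := Finset.mem_image_of_mem _ hy
    rw [← e] at this
    exact (Finset.mem_inter.1 this).1
  have hinv : ∀ x ∈ H, x⁻¹ ∈ H := fun x hx => by simpa using hdiv x hx 1 h1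
  have hmul : ∀ x ∈ H, ∀ y ∈ H, x * y ∈ H := fun x hx y hy => by
    simpa using hdiv x⁻¹ (hinv x hx) y hy
  have hbd : edgeBoundary S H = #H * #(S \ H) := by
    unfold edgeBoundary
    rw [Finset.sum_const_nat (m := #(S \ H))]
    intro c hc
    congr 1
    ext s
    simp only [Finset.mem_filter, Finset.mem_sdiff]
    refine and_congr_right fun _ => not_congr ⟨fun h => ?_, fun h => hmul c hc s h⟩
    simpa using hdiv c hc _ h
  have hne : (S \ H).Nonempty := by
    by_contra hempty
    rw [Finset.not_nonempty_iff_eq_empty, Finset.sdiff_eq_empty_iff_subset] at hempty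
    let K : Subgroup Γ :=
      { carrier := H, mul_mem' := fun {a b} ha hb => hmul a ha b hb, one_mem' := h1,
        inv_mem' := fun {a} ha => hinv a ha }
    have hK : Subgroup.closure (S : Set Γ) ≤ K := (Subgroup.closure_le K).2 hempty
    rw [hgen, top_le_iff] at hK
    have : (Set.univ : Set Γ) ⊆ H := fun x _ => by
      have : x ∈ K := hK ▸ Subgroup.mem_top x
      exact this
    exact Set.infinite_univ (H.finite_toSet.subset this)
  have hSH : #(S ∩ H) + 1 ≤ #H := by
    rw [← Finset.card_erase_add_one h1]
    refine Nat.add_le_add_right (Finset.card_le_card fun s hs => ?_) 1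
    rw [Finset.mem_inter] at hs
    exact Finset.mem_erase.2 ⟨fun e => hone (e ▸ hs.1), hs.2⟩
  have hsplit := Finset.card_inter_add_card_sdiff S H
  rw [← hHb, hbd]
  have hk : 1 ≤ #(S \ H) := hne.card_pos
  nlinarith

end EdgeBoundary

end CayleyMatching

namespace CayleyMatching

open SimpleGraph Finset MeasureTheory
open scoped ENNReal

section Equivariance

variable {Γ : Type*} [Group Γ] {G : SimpleGraph Γ} {f f' : Γ → Γ}

/-- The action of `Γ` on maps `Γ → Γ` by conjugation with left multiplication. -/
def conjMap (g : Γ) (f : Γ → Γ) : Γ → Γ := fun v => g * f (g⁻¹ * v)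

theorem conjMap_mul_apply (g v : Γ) (f : Γ → Γ) : conjMap g f (g * v) = g * f v := by
  simp [conjMap]

theorem conjMap_conjMap (g k : Γ) (f : Γ → Γ) : conjMap g (conjMap k f) = conjMap (g * k) f := by
  ext v
  simp [conjMap, mul_assoc]

theorem conjMap_inv_conjMap (g : Γ) (f : Γ → Γ) : conjMap g⁻¹ (conjMap g f) = f := by
  ext v
  simp [conjMap]

theorem conjMap_apply_eq_iff (g : Γ) (f : Γ → Γ) (v w : Γ) :
    conjMap g f (g * v) = g * w ↔ f v = w := by
  rw [conjMap_mul_apply, mul_right_inj]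

open Classical in
theorem defect_conjMap (g : Γ) (f : Γ → Γ) (F : Finset Γ) :
    defect (conjMap g f) (F.image (g * ·)) = defect f F := by
  unfold defect
  rw [Finset.filter_image, Finset.card_image_of_injective _ (mul_right_injective g)]
  simp only [conjMap_apply_eq_iff]

/-- Left multiplications are automorphisms of `G`. -/
def IsLeftInvariant (G : SimpleGraph Γ) : Prop :=
  ∀ g u v, G.Adj (g * u) (g * v) ↔ G.Adj u v

theorem IsMatchingMap.conjMap (hG : IsLeftInvariant G) (hf : IsMatchingMap G f) (g : Γ) :
    IsMatchingMap G (conjMap g f) := by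
  constructor
  · intro v
    simp [CayleyMatching.conjMap, hf.invol]
  · intro v
    have := hf.adj (g⁻¹ * v)
    rw [← hG g, mul_inv_cancel_left] at this
    refine this.imp (fun h => ?_) id
    simp [CayleyMatching.conjMap, h]

theorem LocEquiv.conjMap (hG : IsLeftInvariant G) (h : LocEquiv G f f') (g : Γ) :
    LocEquiv G (conjMap g f) (conjMap g f') := by
  classical
  obtain ⟨hm, F, hF, hd⟩ := h
  refine ⟨IsMatchingMap.conjMap hG hm g, F.image (g * ·), fun v hv => ?_, ?_⟩
  · simp only [CayleyMatching.conjMap]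
    rw [hF]
    exact fun h => hv (Finset.mem_image.2 ⟨_, h, by simp⟩)
  · rw [defect_conjMap, defect_conjMap, hd]

theorem mul_mem_inessential (hG : IsLeftInvariant G) (g v : Γ) :
    g * v ∈ inessential G (conjMap g f) ↔ v ∈ inessential G f := by
  have key : ∀ (g v : Γ) (f : Γ → Γ), v ∈ inessential G f →
      g * v ∈ inessential G (conjMap g f) := by
    rintro g v f ⟨k, hk, hv⟩
    exact ⟨_, LocEquiv.conjMap hG hk g, by rw [conjMap_mul_apply, hv]⟩
  refine ⟨fun h => ?_, key g v f⟩
  have := key g⁻¹ _ _ h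
  rwa [conjMap_inv_conjMap, inv_mul_cancel_left] at this

theorem linked_conjMap (hG : IsLeftInvariant G) (g u v : Γ) :
    Linked G (conjMap g f) (g * u) (g * v) ↔ Linked G f u v := by
  have key : ∀ (g u v : Γ) (f : Γ → Γ), Linked G f u v →
      Linked G (conjMap g f) (g * u) (g * v) := by
    intro g u v f h
    induction h with
    | refl => exact Relation.ReflTransGen.refl
    | tail _ h ih =>
      refine Relation.ReflTransGen.tail ih ⟨(hG _ _ _).2 h.1, ?_, ?_⟩
      · exact (mul_mem_inessential hG _ _).2 h.2.1
      · exact (mul_mem_inessential hG _ _).2 h.2.2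
  refine ⟨fun h => ?_, key g u v f⟩
  have := key g⁻¹ _ _ _ h
  rwa [conjMap_inv_conjMap, inv_mul_cancel_left, inv_mul_cancel_left] at this

theorem isRoot_conjMap (hG : IsLeftInvariant G) (g v : Γ) :
    IsRoot G (conjMap g f) (g * v) ↔ IsRoot G f v := by
  unfold IsRoot
  rw [mul_mem_inessential hG, conjMap_apply_eq_iff, conjMap_mul_apply, mul_mem_inessential hG]

end Equivariance

section Overwrite

variable {Γ : Type*}

open Classical in
/-- Overwrite `f` by `h` on the finite set `F`. -/
noncomputable def overwrite (F : Finset Γ) (h : F → Γ) (f : Γ → Γ) : Γ → Γ :=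
  fun v => if hv : v ∈ F then h ⟨v, hv⟩ else f v

theorem measurable_overwrite [MeasurableSpace Γ] (F : Finset Γ) (h : F → Γ) :
    Measurable (overwrite F h) := by
  refine measurable_pi_lambda _ fun v => ?_
  by_cases hv : v ∈ F
  · simp only [overwrite, hv, dif_pos]
    exact measurable_const
  · simp only [overwrite, hv, dif_neg, not_false_eq_true]
    exact measurable_pi_apply v

theorem overwrite_eq {F : Finset Γ} {f g : Γ → Γ} (h : ∀ v ∉ F, f v = g v) :
    overwrite F (fun v => g v) f = g := by
  ext v
  by_cases hv : v ∈ F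
  · simp [overwrite, hv]
  · simp [overwrite, hv, h v hv]

end Overwrite

section Measurability

variable {Γ : Type*} [Countable Γ] [MeasurableSpace Γ] [MeasurableSingletonClass Γ]
  (G : SimpleGraph Γ)

theorem measurable_apply_eq (v w : Γ) : Measurable fun f : Γ → Γ => f v = w :=
  measurableSet_setOfPred.1
    (measurableSet_eq_fun (measurable_pi_apply v) (measurable_const (a := w)))

theorem measurable_isMatchingMap : Measurable fun f : Γ → Γ => IsMatchingMap G f := by
  have h : (fun f : Γ → Γ => IsMatchingMap G f) = fun f =>
      (∀ v, ∃ w, f v = w ∧ f w = v) ∧ ∀ v, ∃ w, f v = w ∧ (w = v ∨ G.Adj v w) := by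
    ext f
    exact ⟨fun h => ⟨fun v => ⟨_, rfl, h.1 v⟩, fun v => ⟨_, rfl, h.2 v⟩⟩,
      fun h => ⟨fun v => by obtain ⟨w, h1, h2⟩ := h.1 v; rw [h1, h2],
        fun v => by obtain ⟨w, h1, h2⟩ := h.2 v; rwa [h1]⟩⟩
  rw [h]
  refine Measurable.and (Measurable.forall fun v => Measurable.exists fun w => ?_)
    (Measurable.forall fun v => Measurable.exists fun w => ?_)
  · exact (measurable_apply_eq v w).and (measurable_apply_eq w v)
  · exact (measurable_apply_eq v w).and measurable_const

theorem measurable_defect (F : Finset Γ) : Measurable fun f : Γ → Γ => defect f F := by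
  classical
  have h : (fun f : Γ → Γ => defect f F) = fun f => ∑ v ∈ F, if f v = v then 1 else 0 := by
    ext f
    exact Finset.card_filter _ _
  rw [h]
  refine Finset.measurable_sum _ fun v _ => ?_
  exact Measurable.ite (measurableSet_setOfPred.2 (measurable_apply_eq v v)) measurable_const
    measurable_const

theorem measurable_mem_inessential (v : Γ) : Measurable fun f : Γ → Γ => v ∈ inessential G f := by
  have h : (fun f : Γ → Γ => v ∈ inessential G f) = fun f =>
      ∃ (F : Finset Γ) (h : F → Γ), (IsMatchingMap G (overwrite F h f) ∧
        ∃ n, defect f F = n ∧ defect (overwrite F h f) F = n) ∧ overwrite F h f v = v := by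
    ext f
    constructor
    · rintro ⟨g, ⟨hg, F, hF, hd⟩, hv⟩
      refine ⟨F, fun v => g v, ?_⟩
      rw [overwrite_eq hF]
      exact ⟨⟨hg, _, hd, rfl⟩, hv⟩
    · rintro ⟨F, h, ⟨hg, n, h1, h2⟩, hv⟩
      refine ⟨_, ⟨hg, F, fun w hw => ?_, h1.trans h2.symm⟩, hv⟩
      simp [overwrite, hw]
  rw [h]
  refine Measurable.exists fun F => Measurable.exists fun h => Measurable.and (Measurable.and
    ((measurable_isMatchingMap G).comp (measurable_overwrite F h)) (Measurable.exists fun n =>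
      Measurable.and ?_ ?_)) ?_
  · exact measurableSet_setOfPred.1 (measurable_defect F (measurableSet_singleton n))
  · exact measurableSet_setOfPred.1
      (((measurable_defect F).comp (measurable_overwrite F h)) (measurableSet_singleton n))
  · exact (measurable_apply_eq v v).comp (measurable_overwrite F h)

theorem measurable_apply_mem_inessential (v : Γ) :
    Measurable fun f : Γ → Γ => f v ∈ inessential G f := by
  have h : (fun f : Γ → Γ => f v ∈ inessential G f) = fun f =>
      ∃ w, f v = w ∧ w ∈ inessential G f := by
    ext f
    exact ⟨fun h => ⟨_, rfl, h⟩, fun ⟨w, h1, h2⟩ => h1 ▸ h2⟩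
  rw [h]
  exact Measurable.exists fun w => (measurable_apply_eq v w).and (measurable_mem_inessential G w)

theorem measurable_isRoot (v : Γ) : Measurable fun f : Γ → Γ => IsRoot G f v :=
  (measurable_mem_inessential G v).and
    ((measurable_apply_eq v v).or (measurable_apply_mem_inessential G v).not)

theorem measurable_linked (u v : Γ) : Measurable fun f : Γ → Γ => Linked G f u v := by
  have h : (fun f : Γ → Γ => Linked G f u v) = fun f => ∃ l : List Γ,
      List.IsChain (fun x y => G.Adj x y ∧ x ∈ inessential G f ∧ y ∈ inessential G f) (u :: l) ∧
        (u :: l).getLast (by simp) = v := by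
    ext f
    constructor
    · intro h
      exact List.exists_isChain_cons_of_relationReflTransGen h
    · rintro ⟨l, h1, h2⟩
      exact List.relationReflTransGen_of_exists_isChain_cons l h1 h2
  rw [h]
  refine Measurable.exists fun l => Measurable.and ?_ measurable_const
  clear h
  induction l generalizing u with
  | nil => simp
  | cons w l ih =>
    simp only [List.isChain_cons_cons]
    exact (measurable_const.and ((measurable_mem_inessential G u).and
      (measurable_mem_inessential G w))).and (ih w)

end Measurability

section MassTransport

variable {Γ : Type*} [Group Γ] [Countable Γ] [MeasurableSpace Γ]

/-- The measure `μ` on maps `Γ → Γ` is invariant under the action of `Γ`. -/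
def IsInvariant (μ : Measure (Γ → Γ)) : Prop :=
  ∀ g : Γ, MeasurePreserving (conjMap g) μ μ

/-- The mass transport principle. -/
theorem IsInvariant.mass_transport {μ : Measure (Γ → Γ)} (hμ : IsInvariant μ)
    (φ : Γ → Γ → (Γ → Γ) → ℝ≥0∞) (hφ : ∀ a b, Measurable (φ a b))
    (hinv : ∀ g a b f, φ (g * a) (g * b) (conjMap g f) = φ a b f) :
    ∫⁻ f, ∑' b, φ 1 b f ∂μ = ∫⁻ f, ∑' b, φ b 1 f ∂μ := by
  rw [lintegral_tsum fun b => (hφ 1 b).aemeasurable,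
    lintegral_tsum fun b => (hφ b 1).aemeasurable, ← (Equiv.inv Γ).tsum_eq]
  refine tsum_congr fun b => ?_
  rw [← (hμ b).lintegral_comp (hφ b 1)]
  refine lintegral_congr fun f => ?_
  simpa using (hinv b 1 b⁻¹ f).symm

end MassTransport

end CayleyMatching

namespace CayleyMatching

open SimpleGraph Finset MeasureTheory
open scoped ENNReal

section Minimizer

variable {Γ : Type*} [TopologicalSpace Γ] [DiscreteTopology Γ]

theorem continuous_conjMap [Group Γ] (g : Γ) : Continuous (conjMap g : (Γ → Γ) → Γ → Γ) := by
  refine continuous_pi fun v => ?_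
  exact (continuous_of_discreteTopology (f := (g * ·))).comp (continuous_apply _)

theorem isClopen_apply_mem (v : Γ) (A : Set Γ) : IsClopen {f : Γ → Γ | f v ∈ A} :=
  (isClopen_discrete A).preimage (continuous_apply v)

theorem continuous_apply_apply (v : Γ) : Continuous fun f : Γ → Γ => f (f v) := by
  rw [continuous_iff_continuousAt]
  intro f
  have h : ∀ᶠ k in nhds f, k v = f v :=
    (isClopen_apply_mem v {f v}).isOpen.mem_nhds rfl
  refine ContinuousAt.congr (f := fun k => k (f v)) (continuous_apply _).continuousAt ?_
  filter_upwards [h] with k hk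
  rw [hk]

variable [Group Γ] [Countable Γ] [MeasurableSpace Γ] [BorelSpace Γ] {G : SimpleGraph Γ}

/-- A probability measure that is invariant and concentrated on the matchings of `G`. -/
structure IsInvariantMatching (G : SimpleGraph Γ) (μ : Measure (Γ → Γ)) : Prop where
  prob : IsProbabilityMeasure μ
  invariant : IsInvariant μ
  matching : ∀ᵐ f ∂μ, IsMatchingMap G f

theorem isInvariantMatching_dirac_id : IsInvariantMatching G (Measure.dirac (id : Γ → Γ)) := by
  refine ⟨inferInstance, fun g => ⟨(continuous_conjMap g).measurable, ?_⟩, ?_⟩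
  · rw [Measure.map_dirac' (continuous_conjMap g).measurable]
    congr 1
    ext v
    simp [conjMap]
  · rw [ae_dirac_iff (measurableSet_setOfPred.2 (measurable_isMatchingMap G))]
    exact ⟨fun _ => rfl, fun _ => Or.inl rfl⟩

/-- Some invariant random matching minimizes the probability that a vertex is unmatched. -/
theorem exists_minimizing_invariantMatching (hfin : ∀ v, {w | G.Adj v w}.Finite) :
    ∃ μ : Measure (Γ → Γ), IsInvariantMatching G μ ∧
      ∀ μ', IsInvariantMatching G μ' → μ {f | f 1 = 1} ≤ μ' {f | f 1 = 1} := by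
  let N : Γ → Set Γ := fun v => {w | w = v ∨ G.Adj v w}
  have hN : ∀ v, (N v).Finite := fun v => (Set.finite_singleton v).union (hfin v)
  let C : Γ → Set (Γ → Γ) := fun v => {f | f (f v) = v} ∩ {f | f v ∈ N v}
  have hC : ∀ v, IsClopen (C v) := fun v =>
    ((isClopen_discrete {v}).preimage (continuous_apply_apply v)).inter (isClopen_apply_mem v _)
  have hmatch : ∀ μ : Measure (Γ → Γ), (∀ᵐ f ∂μ, IsMatchingMap G f) ↔ ∀ v, ∀ᵐ f ∂μ, f ∈ C v := by
    intro μ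
    rw [← ae_all_iff]
    refine Filter.eventually_congr (Filter.Eventually.of_forall fun f => ?_)
    exact ⟨fun h v => ⟨h.1 v, h.2 v⟩, fun h => ⟨fun v => (h v).1, fun v => (h v).2⟩⟩
  let I : Set (ProbabilityMeasure (Γ → Γ)) :=
    {μ | (∀ g, μ.map (continuous_conjMap g).aemeasurable = μ) ∧ ∀ v, μ (C v) = 1}
  have hI : ∀ μ : ProbabilityMeasure (Γ → Γ), μ ∈ I ↔ IsInvariantMatching G (μ : Measure _) := by
    intro μ
    have h1 : (∀ g, μ.map (continuous_conjMap g).aemeasurable = μ) ↔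
        IsInvariant (μ : Measure (Γ → Γ)) := by
      refine forall_congr' fun g => ⟨fun h => ⟨(continuous_conjMap g).measurable, ?_⟩, fun h => ?_⟩
      · conv_rhs => rw [← h]
        rfl
      · exact Subtype.ext h.map_eq
    have h2 : (∀ v, μ (C v) = 1) ↔ ∀ᵐ f ∂(μ : Measure (Γ → Γ)), IsMatchingMap G f := by
      rw [hmatch]
      refine forall_congr' fun v => ?_
      rw [← ENNReal.coe_inj, ProbabilityMeasure.ennreal_coeFn_eq_coeFn_toMeasure,
        ENNReal.coe_one, ← prob_compl_eq_zero_iff (hC v).1.measurableSet]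
      rfl
    exact ⟨fun h => ⟨inferInstance, h1.1 h.1, h2.1 h.2⟩, fun h => ⟨h1.2 h.2, h2.2 h.3⟩⟩
  have hclopen : ∀ E : Set (Γ → Γ), IsClopen E →
      Continuous fun μ : ProbabilityMeasure (Γ → Γ) => μ E := fun E hE =>
    continuous_iff_continuousAt.2 fun μ =>
      ProbabilityMeasure.tendsto_measure_of_isClopen_of_tendsto Filter.tendsto_id hE
  have hclosed : IsClosed I := by
    have hI' : I = (⋂ g, {μ | μ.map (continuous_conjMap g).aemeasurable = μ}) ∩
        ⋂ v, {μ | μ (C v) = 1} := by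
      ext μ
      simp [I]
    rw [hI']
    refine IsClosed.inter ?_ ?_
    · exact isClosed_iInter fun g => isClosed_eq
        (ProbabilityMeasure.continuous_map (continuous_conjMap g)) continuous_id
    · exact isClosed_iInter fun v => isClosed_eq (hclopen _ (hC v)) continuous_const
  have hcompact : IsCompact I := by
    rw [← hclosed.closure_eq]
    refine isCompact_closure_of_isTightMeasureSet ?_
    rw [isTightMeasureSet_iff_exists_isCompact_measure_compl_le]
    intro ε _
    refine ⟨Set.pi Set.univ N, isCompact_univ_pi fun v => (hN v).isCompact, ?_⟩
    rintro _ ⟨μ, hμ, rfl⟩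
    have h0 : (μ : Measure (Γ → Γ)) (Set.pi Set.univ N)ᶜ = 0 := by
      filter_upwards [((hI μ).1 hμ).matching] with f hf v _
      exact hf.2 v
    rw [h0]
    exact zero_le
  have hne : I.Nonempty := ⟨⟨_, Measure.dirac.isProbabilityMeasure (x := id)⟩,
    (hI _).2 isInvariantMatching_dirac_id⟩
  obtain ⟨μ, hμ, hmin⟩ := hcompact.exists_isMinOn hne
    (hclopen {f : Γ → Γ | f 1 = 1} (isClopen_apply_mem 1 {1})).continuousOn
  refine ⟨μ, (hI μ).1 hμ, fun μ' hμ' => ?_⟩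
  let ρ : ProbabilityMeasure (Γ → Γ) := ⟨μ', hμ'.prob⟩
  have := isMinOn_iff.1 hmin ρ ((hI _).2 hμ')
  rw [← ENNReal.coe_le_coe, ProbabilityMeasure.ennreal_coeFn_eq_coeFn_toMeasure,
    ProbabilityMeasure.ennreal_coeFn_eq_coeFn_toMeasure] at this
  exact this

end Minimizer

end CayleyMatching

namespace CayleyMatching

open SimpleGraph Finset MeasureTheory
open scoped ENNReal

section CoinFlips

variable {Γ : Type*} [Group Γ]

/-- The action of `Γ` on `{0,1}^Γ` by left translation. -/
def shiftBits (g : Γ) (ξ : Γ → Bool) : Γ → Bool := fun v => ξ (g⁻¹ * v)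

variable (Γ) in
/-- The law of independent fair coin flips indexed by `Γ`. -/
noncomputable def coinFlips : Measure (Γ → Bool) :=
  Measure.infinitePi fun _ => (PMF.uniformOfFintype Bool).toMeasure

instance : IsProbabilityMeasure (coinFlips Γ) := by
  unfold coinFlips
  infer_instance

theorem measurable_shiftBits (g : Γ) : Measurable (shiftBits g) :=
  measurable_pi_lambda _ fun _ => measurable_pi_apply _

theorem measurePreserving_shiftBits (g : Γ) :
    MeasurePreserving (shiftBits g) (coinFlips Γ) (coinFlips Γ) := by
  refine ⟨measurable_shiftBits g, ?_⟩
  have h := Measure.infinitePi_map_piCongrLeft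
    (μ := fun _ : Γ => (PMF.uniformOfFintype Bool).toMeasure) (Equiv.mulLeft g)
  have e : (shiftBits g : (Γ → Bool) → Γ → Bool) =
      MeasurableEquiv.piCongrLeft (fun _ => Bool) (Equiv.mulLeft g) := by
    ext ξ v
    have := MeasurableEquiv.piCongrLeft_apply_apply (Equiv.mulLeft g) (β := fun _ => Bool) ξ
      (g⁻¹ * v)
    simp only [Equiv.coe_mulLeft, mul_inv_cancel_left] at this
    rw [this]
    rfl
  rw [e]
  exact h

/-- The selected elements of `Γ`, whose translates of `F` are pairwise disjoint. -/
def Selected (F : Finset Γ) (ξ : Γ → Bool) (g : Γ) : Prop :=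
  ξ g = true ∧ ∀ v ∈ F, ∀ w ∈ F, v ≠ w → ξ (g * (v * w⁻¹)) = false

theorem Selected.eq {F : Finset Γ} {ξ : Γ → Bool} {g k v w : Γ} (hg : Selected F ξ g)
    (hk : Selected F ξ k) (hv : v ∈ F) (hw : w ∈ F) (h : g * v = k * w) : v = w := by
  by_contra hne
  have h1 := hg.2 v hv w hw hne
  rw [← mul_assoc, h, mul_inv_cancel_right, hk.1] at h1
  exact absurd h1 (by simp)

theorem selected_shiftBits (F : Finset Γ) (ξ : Γ → Bool) (k g : Γ) :
    Selected F (shiftBits k ξ) (k * g) ↔ Selected F ξ g := by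
  simp [Selected, shiftBits, mul_assoc]

theorem measurableSet_selected (F : Finset Γ) (g : Γ) :
    MeasurableSet {ξ | Selected F ξ g} := by
  have hb : ∀ (v : Γ) (b : Bool), MeasurableSet {ξ : Γ → Bool | ξ v = b} := fun v b =>
    measurableSet_eq_fun (measurable_pi_apply v) measurable_const
  have : {ξ | Selected F ξ g} = {ξ | ξ g = true} ∩ ⋂ v ∈ F, ⋂ w ∈ F, ⋂ (_ : v ≠ w),
      {ξ : Γ → Bool | ξ (g * (v * w⁻¹)) = false} := by
    ext ξ
    simp [Selected]
  rw [this]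
  exact (hb _ _).inter (Finset.measurableSet_biInter _ fun v _ =>
    Finset.measurableSet_biInter _ fun w _ => MeasurableSet.iInter fun _ => hb _ _)

theorem coinFlips_selected_pos (F : Finset Γ) : coinFlips Γ {ξ | Selected F ξ 1} ≠ 0 := by
  classical
  let B : Finset Γ := insert 1 (Finset.image₂ (fun v w => v * w⁻¹) F F)
  have hsub : Set.pi (B : Set Γ) (fun v => {decide (v = 1)}) ⊆ {ξ | Selected F ξ 1} := by
    intro ξ hξ
    have h : ∀ v ∈ B, ξ v = decide (v = 1) := fun v hv => hξ v hv
    refine ⟨by simpa using h 1 (Finset.mem_insert_self _ _), fun v hv w hw hne => ?_⟩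
    rw [one_mul, h _ (Finset.mem_insert_of_mem (Finset.mem_image₂_of_mem hv hw))]
    simpa [mul_inv_eq_one] using hne
  refine fun h0 => ?_
  have := measure_mono_null hsub h0
  unfold coinFlips at this
  rw [Measure.infinitePi_pi _ (fun _ _ => measurableSet_singleton _)] at this
  simp [Finset.prod_eq_zero_iff] at this

end CoinFlips

section Patching

variable {Γ : Type*}

/-- The matchings that the pattern `h` improves on the finite set `F`. -/
def Improvable (F : Finset Γ) (h : Γ → Γ) : Set (Γ → Γ) :=
  {f | (∀ v ∈ F, f v ∈ F) ∧ defect h F < defect f F}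

theorem measurableSet_improvable [Countable Γ] [MeasurableSpace Γ]
    [MeasurableSingletonClass Γ] (F : Finset Γ) (h : Γ → Γ) : MeasurableSet (Improvable F h) := by
  have : Improvable F h = (⋂ v ∈ F, {f | f v ∈ (F : Set Γ)}) ∩ {f | defect h F < defect f F} := by
    ext f
    simp [Improvable]
  rw [this]
  exact (Finset.measurableSet_biInter _ fun v _ =>
    measurable_pi_apply v F.finite_toSet.measurableSet).inter
      (measurableSet_lt measurable_const (measurable_defect F))

variable [Group Γ]

/-- The translate by `g` of the pattern `h` on `F` is to be used. -/
def Active (F : Finset Γ) (h : Γ → Γ) (ω : (Γ → Γ) × (Γ → Bool)) (g : Γ) : Prop :=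
  Selected F ω.2 g ∧ conjMap g⁻¹ ω.1 ∈ Improvable F h

open Classical in
/-- Apply all active translates of the pattern `h` on `F`. -/
noncomputable def patch (F : Finset Γ) (h : Γ → Γ) (ω : (Γ → Γ) × (Γ → Bool)) : Γ → Γ :=
  fun v => if hv : ∃ w ∈ F, Active F h ω (v * w⁻¹) then v * hv.choose⁻¹ * h hv.choose else ω.1 v

/-- The joint action on matchings and coin flips. -/
def jointShift (g : Γ) (ω : (Γ → Γ) × (Γ → Bool)) : (Γ → Γ) × (Γ → Bool) :=
  (conjMap g ω.1, shiftBits g ω.2)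

variable {F : Finset Γ} {h : Γ → Γ} {ω : (Γ → Γ) × (Γ → Bool)}

theorem patch_of_active {v w : Γ} (hw : w ∈ F) (ha : Active F h ω (v * w⁻¹)) :
    patch F h ω v = v * w⁻¹ * h w := by
  have hv : ∃ w ∈ F, Active F h ω (v * w⁻¹) := ⟨w, hw, ha⟩
  have e : hv.choose = w :=
    hv.choose_spec.2.1.eq ha.1 hv.choose_spec.1 hw (by simp)
  unfold patch
  rw [dif_pos hv, e]

theorem patch_of_not_active {v : Γ} (hv : ¬ ∃ w ∈ F, Active F h ω (v * w⁻¹)) :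
    patch F h ω v = ω.1 v := by
  unfold patch
  rw [dif_neg hv]

theorem active_jointShift (k g : Γ) :
    Active F h (jointShift k ω) (k * g) ↔ Active F h ω g := by
  unfold Active jointShift
  rw [selected_shiftBits, conjMap_conjMap]
  simp

theorem patch_jointShift (k : Γ) : patch F h (jointShift k ω) = conjMap k (patch F h ω) := by
  ext v
  obtain ⟨u, rfl⟩ : ∃ u, v = k * u := ⟨k⁻¹ * v, by simp⟩
  rw [conjMap_mul_apply]
  by_cases hu : ∃ w ∈ F, Active F h ω (u * w⁻¹)
  · obtain ⟨w, hw, ha⟩ := hu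
    rw [patch_of_active hw ha, patch_of_active hw (by rwa [mul_assoc, active_jointShift])]
    simp [mul_assoc]
  · rw [patch_of_not_active hu, patch_of_not_active (by simpa only [mul_assoc, active_jointShift])]
    exact conjMap_mul_apply _ _ _

theorem isMatchingMap_patch {G : SimpleGraph Γ} (hG : IsLeftInvariant G)
    (hh : IsMatchingMap G h) (hF : ∀ v ∈ F, h v ∈ F) (hω : IsMatchingMap G ω.1) :
    IsMatchingMap G (patch F h ω) := by
  have hact : ∀ g w, w ∈ F → Active F h ω g → patch F h ω (g * w) = g * h w := by
    intro g w hw ha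
    rw [patch_of_active hw (by simpa using ha)]
    simp
  have hcases : ∀ v, (∃ g w, w ∈ F ∧ Active F h ω g ∧ v = g * w) ∨
      ¬ ∃ w ∈ F, Active F h ω (v * w⁻¹) := by
    intro v
    by_cases hv : ∃ w ∈ F, Active F h ω (v * w⁻¹)
    · obtain ⟨w, hw, ha⟩ := hv
      exact Or.inl ⟨_, w, hw, ha, by simp⟩
    · exact Or.inr hv
  constructor
  · intro v
    rcases hcases v with ⟨g, w, hw, ha, rfl⟩ | hv
    · rw [hact g w hw ha, hact g _ (hF w hw) ha, hh.invol]
    · rw [patch_of_not_active hv, patch_of_not_active, hω.invol]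
      rintro ⟨w, hw, ha⟩
      apply hv
      have := ha.2.1 w hw
      simp only [conjMap, inv_inv, inv_mul_cancel_right, hω.invol] at this
      exact ⟨_, this, by simpa using ha⟩
  · intro v
    rcases hcases v with ⟨g, w, hw, ha, rfl⟩ | hv
    · rw [hact g w hw ha, hG, mul_right_inj]
      exact hh.adj w
    · rw [patch_of_not_active hv]
      exact hω.adj v

variable [Countable Γ] [MeasurableSpace Γ] [MeasurableSingletonClass Γ]

theorem measurable_conjMap (g : Γ) : Measurable (conjMap g : (Γ → Γ) → Γ → Γ) :=
  measurable_pi_lambda _ fun _ => (measurable_of_countable (g * ·)).comp (measurable_pi_apply _)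

theorem measurable_jointShift (g : Γ) : Measurable (jointShift (Γ := Γ) g) :=
  ((measurable_conjMap g).comp measurable_fst).prodMk
    ((measurable_shiftBits g).comp measurable_snd)

theorem measurableSet_active (F : Finset Γ) (h : Γ → Γ) (g : Γ) :
    MeasurableSet {ω | Active F h ω g} :=
  (measurable_snd (measurableSet_selected F g)).inter
    (((measurable_conjMap g⁻¹).comp measurable_fst) (measurableSet_improvable F h))

theorem measurableSet_exists_active (F : Finset Γ) (h : Γ → Γ) (v : Γ) :
    MeasurableSet {ω | ∃ w ∈ F, Active F h ω (v * w⁻¹)} := by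
  have : {ω | ∃ w ∈ F, Active F h ω (v * w⁻¹)} = ⋃ w ∈ F, {ω | Active F h ω (v * w⁻¹)} := by
    ext ω
    simp
  rw [this]
  exact Finset.measurableSet_biUnion _ fun w _ => measurableSet_active F h _

theorem measurable_patch (F : Finset Γ) (h : Γ → Γ) : Measurable (patch F h) := by
  refine measurable_pi_lambda _ fun v => measurable_to_countable' fun u => ?_
  have : (fun ω => patch F h ω v) ⁻¹' {u} =
      (⋃ w ∈ F, ({ω | Active F h ω (v * w⁻¹)} ∩ {_ω | v * w⁻¹ * h w = u})) ∪
      ({ω | ∃ w ∈ F, Active F h ω (v * w⁻¹)}ᶜ ∩ {ω | ω.1 v = u}) := by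
    ext ω
    by_cases hv : ∃ w ∈ F, Active F h ω (v * w⁻¹)
    · obtain ⟨w, hw, ha⟩ := hv
      simp only [Set.mem_preimage, Set.mem_singleton_iff, patch_of_active hw ha, Set.mem_union,
        Set.mem_iUnion, Set.mem_inter_iff, Set.mem_ofPred_eq, Set.mem_compl_iff]
      constructor
      · exact fun hu => Or.inl ⟨w, hw, ha, hu⟩
      · rintro (⟨w', hw', ha', hu⟩ | ⟨hn, _⟩)
        · rwa [← patch_of_active hw ha, patch_of_active hw' ha']
        · exact absurd ⟨w, hw, ha⟩ hn
    · simp only [Set.mem_preimage, Set.mem_singleton_iff, patch_of_not_active hv, Set.mem_union,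
        Set.mem_iUnion, Set.mem_inter_iff, Set.mem_ofPred_eq, Set.mem_compl_iff]
      constructor
      · exact fun hu => Or.inr ⟨hv, hu⟩
      · rintro (⟨w', hw', ha', hu⟩ | ⟨_, hu⟩)
        · exact absurd ⟨w', hw', ha'⟩ hv
        · exact hu
  rw [this]
  refine (Finset.measurableSet_biUnion _ fun w _ => (measurableSet_active F h _).inter
    (MeasurableSet.const _)).union ((measurableSet_exists_active F h v).compl.inter ?_)
  exact measurableSet_eq_fun ((measurable_pi_apply v).comp measurable_fst) measurable_const

/-- The probability that `1` is unmatched by `Ψ` and covered by an active translate of `F`. -/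
theorem measure_fixed_inter_active {π : Measure ((Γ → Γ) × (Γ → Bool))}
    (hπ : ∀ g, MeasurePreserving (jointShift g) π π) {Ψ : (Γ → Γ) × (Γ → Bool) → Γ → Γ}
    (hΨ : Measurable Ψ) (hinv : ∀ g ω, Ψ (jointShift g ω) = conjMap g (Ψ ω)) :
    π ({ω | Ψ ω 1 = 1} ∩ {ω | ∃ w ∈ F, Active F h ω (1 * w⁻¹)}) =
      ∑ w ∈ F, π ({ω | Active F h ω 1} ∩ {ω | Ψ ω w = w}) := by
  have hfix : ∀ w, MeasurableSet {ω | Ψ ω w = w} := fun w =>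
    measurableSet_eq_fun ((measurable_pi_apply w).comp hΨ) measurable_const
  have hset : {ω | Ψ ω 1 = 1} ∩ {ω | ∃ w ∈ F, Active F h ω (1 * w⁻¹)} =
      ⋃ w ∈ F, ({ω | Active F h ω w⁻¹} ∩ {ω | Ψ ω 1 = 1}) := by
    ext ω
    simp only [one_mul, Set.mem_inter_iff, Set.mem_ofPred_eq, Set.mem_iUnion]
    exact ⟨fun ⟨h1, w, hw, ha⟩ => ⟨w, hw, ha, h1⟩, fun ⟨w, hw, ha, h1⟩ => ⟨h1, w, hw, ha⟩⟩
  rw [hset, measure_biUnion_finset]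
  · refine Finset.sum_congr rfl fun w _ => ?_
    rw [← (hπ w⁻¹).measure_preimage
      ((measurableSet_active F h w⁻¹).inter (hfix 1)).nullMeasurableSet]
    congr 1
    ext ω
    have h1 := active_jointShift (F := F) (h := h) (ω := ω) w⁻¹ 1
    have h2 := conjMap_apply_eq_iff w⁻¹ (Ψ ω) w w
    rw [mul_one] at h1
    rw [inv_mul_cancel] at h2
    simp only [Set.mem_preimage, Set.mem_inter_iff, Set.mem_ofPred_eq, h1, hinv, h2]
  · intro w hw w' hw' hne
    refine Set.disjoint_left.2 fun ω h1 h2 => hne ?_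
    exact h1.1.1.eq h2.1.1 hw hw' (by simp)
  · exact fun w _ => (measurableSet_active F h _).inter (hfix 1)

end Patching

section Improvement

variable {Γ : Type*} [Group Γ] [Countable Γ] [TopologicalSpace Γ] [DiscreteTopology Γ]
  [MeasurableSpace Γ] [BorelSpace Γ] {G : SimpleGraph Γ} {μ : Measure (Γ → Γ)}

/-- An invariant random matching with an improvable pattern is not minimizing. -/
theorem IsInvariantMatching.exists_lt (hG : IsLeftInvariant G) (hμ : IsInvariantMatching G μ)
    {F : Finset Γ} {h : Γ → Γ} (hh : IsMatchingMap G h) (hF : ∀ v ∈ F, h v ∈ F)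
    (hpos : μ (Improvable F h) ≠ 0) :
    ∃ μ', IsInvariantMatching G μ' ∧ μ' {f | f 1 = 1} < μ {f | f 1 = 1} := by
  have := hμ.prob
  set π := μ.prod (coinFlips Γ) with hπdef
  have hπ : ∀ g, MeasurePreserving (jointShift g) π π := fun g =>
    (hμ.invariant g).prod (measurePreserving_shiftBits g)
  have hmeas := measurable_patch F h
  have hmatch : ∀ᵐ ω ∂π, IsMatchingMap G ω.1 :=
    Measure.quasiMeasurePreserving_fst.ae hμ.matching
  have hfix : MeasurableSet {f : Γ → Γ | f 1 = 1} :=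
    measurableSet_setOfPred.2 (measurable_apply_eq 1 1)
  refine ⟨π.map (patch F h), ⟨Measure.isProbabilityMeasure_map hmeas.aemeasurable, fun g =>
    ⟨measurable_conjMap g, ?_⟩, ?_⟩, ?_⟩
  · rw [Measure.map_map (measurable_conjMap g) hmeas]
    have : conjMap g ∘ patch F h = patch F h ∘ jointShift g := by
      ext1 ω
      exact (patch_jointShift g).symm
    rw [this, ← Measure.map_map hmeas (measurable_jointShift g), (hπ g).map_eq]
  · rw [ae_map_iff hmeas.aemeasurable (measurableSet_setOfPred.2 (measurable_isMatchingMap G))]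
    filter_upwards [hmatch] with ω hω
    exact isMatchingMap_patch hG hh hF hω
  · have hμπ : μ {f | f 1 = 1} = π {ω | ω.1 1 = 1} := by
      have : {ω : (Γ → Γ) × (Γ → Bool) | ω.1 1 = 1} = {f : Γ → Γ | f 1 = 1} ×ˢ Set.univ := by
        ext ω
        simp
      rw [this, hπdef, Measure.prod_prod, measure_univ, mul_one]
    rw [Measure.map_apply hmeas hfix, hμπ]
    change π {ω | patch F h ω 1 = 1} < _
    have hcov := measurableSet_exists_active F h 1
    rw [← measure_inter_add_sdiff {ω | patch F h ω 1 = 1} hcov,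
      ← measure_inter_add_sdiff {ω : (Γ → Γ) × (Γ → Bool) | ω.1 1 = 1} hcov,
      measure_fixed_inter_active hπ hmeas (fun g _ => patch_jointShift g),
      measure_fixed_inter_active hπ measurable_fst (fun _ _ => rfl)]
    have hdiff : {ω | patch F h ω 1 = 1} \ {ω | ∃ w ∈ F, Active F h ω (1 * w⁻¹)} =
        {ω | ω.1 1 = 1} \ {ω | ∃ w ∈ F, Active F h ω (1 * w⁻¹)} := by
      ext ω
      simp only [Set.mem_sdiff, Set.mem_ofPred_eq]
      exact and_congr_left fun hn => by rw [patch_of_not_active hn]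
    rw [hdiff]
    refine ENNReal.add_lt_add_right (measure_ne_top _ _) ?_
    set A := {ω | Active F h ω 1} with hA
    have hAmeas : MeasurableSet A := measurableSet_active F h 1
    have hAne : π A ≠ 0 := by
      have : A = Improvable F h ×ˢ {ξ | Selected F ξ 1} := by
        ext ω
        have : conjMap (1 : Γ)⁻¹ ω.1 = ω.1 := by ext v; simp [conjMap]
        simp only [hA, Active, this, Set.mem_ofPred_eq, Set.mem_prod]
        exact and_comm
      rw [this, hπdef, Measure.prod_prod]
      exact mul_ne_zero hpos (coinFlips_selected_pos F)
    have key : ∀ Ψ : (Γ → Γ) × (Γ → Bool) → Γ → Γ, Measurable Ψ →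
        ∑ w ∈ F, π (A ∩ {ω | Ψ ω w = w}) = ∫⁻ ω in A, (defect (Ψ ω) F : ℝ≥0∞) ∂π := by
      classical
      intro Ψ hΨ
      have hfix : ∀ w, MeasurableSet {ω | Ψ ω w = w} := fun w =>
        measurableSet_eq_fun ((measurable_pi_apply w).comp hΨ) measurable_const
      have e : ∀ ω, (defect (Ψ ω) F : ℝ≥0∞) =
          ∑ w ∈ F, {ω | Ψ ω w = w}.indicator (fun _ => (1 : ℝ≥0∞)) ω := by
        intro ω
        unfold defect
        rw [Finset.card_filter]
        push_cast
        refine Finset.sum_congr rfl fun w _ => ?_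
        simp [Set.indicator_apply]
      simp only [e]
      rw [lintegral_finsetSum _ fun w _ => measurable_const.indicator (hfix w)]
      refine Finset.sum_congr rfl fun w _ => ?_
      rw [lintegral_indicator_const (hfix w), one_mul, Measure.restrict_apply (hfix w),
        Set.inter_comm]
    rw [key _ hmeas, key _ measurable_fst]
    have h1 : ∫⁻ ω in A, (defect (patch F h ω) F : ℝ≥0∞) ∂π = defect h F * π A := by
      rw [← setLIntegral_const]
      refine setLIntegral_congr_fun hAmeas fun ω hω => ?_
      congr 1
      refine defect_congr fun v hv => ?_
      have ha : Active F h ω 1 := hω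
      rw [patch_of_active hv (by simpa using ha)]
      simp
    have h2 : (defect h F + 1) * π A ≤ ∫⁻ ω in A, (defect ω.1 F : ℝ≥0∞) ∂π := by
      rw [← setLIntegral_const]
      refine setLIntegral_mono' hAmeas fun ω hω => ?_
      have := hω.2.2
      have e : conjMap (1 : Γ)⁻¹ ω.1 = ω.1 := by ext v; simp [conjMap]
      rw [e] at this
      exact_mod_cast this
    rw [h1]
    refine lt_of_lt_of_le ?_ h2
    rw [add_mul, one_mul]
    exact ENNReal.lt_add_right (ENNReal.mul_ne_top (ENNReal.natCast_ne_top _)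
      (measure_ne_top _ _)) hAne

/-- A minimizing invariant random matching is almost surely locally maximum. -/
theorem IsInvariantMatching.ae_isLocMax (hG : IsLeftInvariant G) (hμ : IsInvariantMatching G μ)
    (hmin : ∀ μ', IsInvariantMatching G μ' → μ {f | f 1 = 1} ≤ μ' {f | f 1 = 1}) :
    ∀ᵐ f ∂μ, IsLocMax G f := by
  have hnull : ∀ (F : Finset Γ) (h : F → Γ), IsMatchingMap G (overwrite F h id) →
      (∀ v ∈ F, overwrite F h id v ∈ F) → ∀ᵐ f ∂μ, f ∉ Improvable F (overwrite F h id) := by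
    intro F h hh hF
    by_contra hpos
    obtain ⟨μ', hμ', hlt⟩ := hμ.exists_lt hG hh hF
      (fun h0 => hpos (measure_eq_zero_iff_ae_notMem.1 h0))
    exact absurd (hmin μ' hμ') (not_le.2 hlt)
  have hall : ∀ᵐ f ∂μ, ∀ (F : Finset Γ) (h : F → Γ), IsMatchingMap G (overwrite F h id) →
      (∀ v ∈ F, overwrite F h id v ∈ F) → f ∉ Improvable F (overwrite F h id) := by
    rw [ae_all_iff]
    intro F
    rw [ae_all_iff]
    intro h
    by_cases hh : IsMatchingMap G (overwrite F h id)
    · by_cases hF : ∀ v ∈ F, overwrite F h id v ∈ F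
      · filter_upwards [hnull F h hh hF] with f hf _ _ using hf
      · exact Filter.Eventually.of_forall fun f _ h' => absurd h' hF
    · exact Filter.Eventually.of_forall fun f h' => absurd h' hh
  filter_upwards [hall, hμ.matching] with f hf hm
  refine ⟨hm, fun g hg F hF => ?_⟩
  obtain ⟨F', hFF, hfF, hgF⟩ := exists_closed_superset hm.invol hg.invol F hF
  have hext : ∀ v ∈ F', overwrite F' (fun v => g v) id v = g v := fun v hv => by
    simp [overwrite, hv]
  have hext' : ∀ v ∉ F', overwrite F' (fun v => g v) id v = v := fun v hv => by
    simp [overwrite, hv]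
  have hm' : IsMatchingMap G (overwrite F' (fun v => g v) id) := by
    constructor
    · intro v
      by_cases hv : v ∈ F'
      · rw [hext v hv, hext _ (hgF v hv), hg.invol]
      · rw [hext' v hv, hext' v hv]
    · intro v
      by_cases hv : v ∈ F'
      · rw [hext v hv]
        exact hg.adj v
      · exact Or.inl (hext' v hv)
  have := hf F' (fun v => g v) hm' (fun v hv => by rw [hext v hv]; exact hgF v hv)
  simp only [Improvable, Set.mem_ofPred_eq, not_and, not_lt] at this
  have h1 := this hfF
  rw [defect_congr hext] at h1
  have h2 := defect_superset hFF hF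
  omega

end Improvement

end CayleyMatching

namespace CayleyMatching

open SimpleGraph Finset MeasureTheory
open scoped ENNReal

section Linked

variable {V : Type*} {G : SimpleGraph V} {f : V → V}

theorem Linked.symm {u v : V} (h : Linked G f u v) : Linked G f v u := by
  induction h with
  | refl => exact Relation.ReflTransGen.refl
  | tail _ h ih => exact Relation.ReflTransGen.head ⟨h.1.symm, h.2.2, h.2.1⟩ ih

theorem Linked.mem_inessential {u v : V} (h : Linked G f u v) (hv : v ∈ inessential G f) :
    u ∈ inessential G f := by
  rcases Relation.ReflTransGen.cases_head h with rfl | ⟨w, hw, _⟩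
  · exact hv
  · exact hw.2.1

end Linked

section Saturation

theorem lintegral_ite_one {α : Type*} [MeasurableSpace α] {μ : Measure α} {p : α → Prop}
    [DecidablePred p] (hp : Measurable p) :
    ∫⁻ x, (if p x then 1 else 0) ∂μ = μ {x | p x} := by
  rw [← lintegral_indicator_one (measurableSet_setOfPred.2 hp)]
  refine lintegral_congr fun x => ?_
  simp [Set.indicator_apply]

theorem measurable_ite_one {α : Type*} [MeasurableSpace α] {p : α → Prop}
    [DecidablePred p] (hp : Measurable p) : Measurable fun x => if p x then (1 : ℝ≥0∞) else 0 :=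
  Measurable.ite (measurableSet_setOfPred.2 hp) measurable_const measurable_const

variable {Γ : Type*} [Group Γ]

theorem isLeftInvariant_mulCayley (S : Set Γ) : IsLeftInvariant (mulCayley S) :=
  fun _ _ _ => mulCayley_adj_mul_iff_right

theorem mulCayley_adj_iff {S : Set Γ} (hsym : ∀ s ∈ S, s⁻¹ ∈ S) (hone : (1 : Γ) ∉ S) (u v : Γ) :
    (mulCayley S).Adj u v ↔ u⁻¹ * v ∈ S := by
  rw [mulCayley_adj]
  constructor
  · rintro ⟨_, h | h⟩
    · exact h
    · simpa using hsym _ h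
  · intro h
    refine ⟨?_, Or.inl h⟩
    rintro rfl
    exact hone (by simpa using h)

variable [Countable Γ] [MeasurableSpace Γ] [MeasurableSingletonClass Γ] {G : SimpleGraph Γ}
  {μ : Measure (Γ → Γ)}

open Classical in
/-- Components with a root are almost surely finite. -/
theorem IsInvariant.ae_finite_linked [IsProbabilityMeasure μ] (hG : IsLeftInvariant G)
    (hμ : IsInvariant μ) (hmax : ∀ᵐ f ∂μ, IsLocMax G f) :
    ∀ᵐ f ∂μ, IsRoot G f 1 → {a | Linked G f a 1}.Finite := by
  let φ : Γ → Γ → (Γ → Γ) → ℝ≥0∞ := fun a b f => if IsRoot G f b ∧ Linked G f a b then 1 else 0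
  have hφ : ∀ a b, Measurable (φ a b) := fun a b =>
    measurable_ite_one ((measurable_isRoot G b).and (measurable_linked G a b))
  have hinv : ∀ g a b f, φ (g * a) (g * b) (conjMap g f) = φ a b f := by
    intro g a b f
    simp only [φ, isRoot_conjMap hG, linked_conjMap hG]
  have hle : ∫⁻ f, ∑' b, φ 1 b f ∂μ ≤ 1 := by
    calc ∫⁻ f, ∑' b, φ 1 b f ∂μ ≤ ∫⁻ _, 1 ∂μ := by
          refine lintegral_mono_ae ?_
          filter_upwards [hmax] with f hf
          by_cases h : ∃ b, IsRoot G f b ∧ Linked G f 1 b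
          · obtain ⟨b, hb, hl⟩ := h
            rw [tsum_eq_single b]
            · simp only [φ]
              split_ifs <;> simp
            · intro b' hb'
              refine if_neg fun ⟨h1, h2⟩ => hb' ?_
              exact hf.root_unique h1 hb (h2.symm.trans hl)
          · push Not at h
            rw [ENNReal.tsum_eq_zero.2 fun b => if_neg fun h' => h b h'.1 h'.2]
            exact zero_le
      _ = 1 := by simp
  rw [hμ.mass_transport φ hφ hinv] at hle
  have hae := ae_lt_top (Measurable.tsum fun b => hφ b 1)
    (ne_top_of_le_ne_top ENNReal.one_ne_top hle)
  filter_upwards [hae] with f hf hr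
  have := ENNReal.finite_const_le_of_tsum_ne_top hf.ne one_ne_zero
  refine this.subset fun a ha => ?_
  have ha' : Linked G f a 1 := ha
  simp [φ, hr, ha']

open Classical in
/-- In an invariant matching, as many vertices are matched out of the inessential set as into
it. -/
theorem IsInvariant.measure_matched_out (hG : IsLeftInvariant G)
    (hμ : IsInvariant μ) (hm : ∀ᵐ f ∂μ, IsMatchingMap G f) :
    μ {f | 1 ∉ inessential G f ∧ f 1 ∈ inessential G f} =
      μ {f | 1 ∈ inessential G f ∧ f 1 ∉ inessential G f} := by
  let φ : Γ → Γ → (Γ → Γ) → ℝ≥0∞ := fun a b f =>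
    if f a = b ∧ a ∉ inessential G f ∧ b ∈ inessential G f then 1 else 0
  have hφ : ∀ a b, Measurable (φ a b) := fun a b =>
    measurable_ite_one ((measurable_apply_eq a b).and
      ((measurable_mem_inessential G a).not.and (measurable_mem_inessential G b)))
  have hinv : ∀ g a b f, φ (g * a) (g * b) (conjMap g f) = φ a b f := by
    intro g a b f
    simp only [φ, conjMap_apply_eq_iff, mul_mem_inessential hG]
  have key := hμ.mass_transport φ hφ hinv
  have h1 : ∫⁻ f, ∑' b, φ 1 b f ∂μ = μ {f | 1 ∉ inessential G f ∧ f 1 ∈ inessential G f} := by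
    rw [← lintegral_ite_one ((measurable_mem_inessential G 1).not.and
      (measurable_apply_mem_inessential G 1))]
    refine lintegral_congr fun f => ?_
    rw [tsum_eq_single (f 1)]
    · simp [φ]
    · exact fun b hb => if_neg fun h => hb h.1.symm
  have h2 : ∫⁻ f, ∑' b, φ b 1 f ∂μ = μ {f | 1 ∈ inessential G f ∧ f 1 ∉ inessential G f} := by
    rw [← lintegral_ite_one ((measurable_mem_inessential G 1).and
      (measurable_apply_mem_inessential G 1).not)]
    refine lintegral_congr_ae ?_
    filter_upwards [hm] with f hf
    rw [tsum_eq_single (f 1)]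
    · simp [φ, hf.invol, and_comm]
    · refine fun b hb => if_neg fun h => hb ?_
      rw [← h.1, hf.invol]
  rw [← h1, key, h2]

open Classical in
/-- The number of edges leaving the inessential set is at most `#S` per essential neighbour. -/
theorem IsInvariant.lintegral_boundary_le {S : Finset Γ} (hμ : IsInvariant μ)
    (hsym : ∀ s ∈ S, s⁻¹ ∈ S) (hone : (1 : Γ) ∉ S)
    (hmax : ∀ᵐ f ∂μ, IsLocMax (mulCayley (S : Set Γ)) f) :
    ∫⁻ f, (∑ s ∈ S, if 1 ∈ inessential (mulCayley (S : Set Γ)) f ∧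
        s ∉ inessential (mulCayley (S : Set Γ)) f then 1 else 0) ∂μ ≤
      #S * μ {f | 1 ∉ inessential (mulCayley (S : Set Γ)) f ∧
        f 1 ∈ inessential (mulCayley (S : Set Γ)) f} := by
  set G := mulCayley (S : Set Γ) with hGdef
  have hG : IsLeftInvariant G := isLeftInvariant_mulCayley _
  let φ : Γ → Γ → (Γ → Γ) → ℝ≥0∞ := fun a b f =>
    if a⁻¹ * b ∈ S ∧ a ∈ inessential G f ∧ b ∉ inessential G f then 1 else 0
  have hφ : ∀ a b, Measurable (φ a b) := fun a b =>
    measurable_ite_one (measurable_const.and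
      ((measurable_mem_inessential G a).and (measurable_mem_inessential G b).not))
  have hinv : ∀ g a b f, φ (g * a) (g * b) (conjMap g f) = φ a b f := by
    intro g a b f
    simp only [φ, mul_mem_inessential hG]
    simp [mul_assoc]
  have key := hμ.mass_transport φ hφ hinv
  have h1 : ∀ f, ∑' b, φ 1 b f =
      ∑ s ∈ S, if 1 ∈ inessential G f ∧ s ∉ inessential G f then 1 else 0 := by
    intro f
    rw [tsum_eq_sum (s := S)]
    · refine Finset.sum_congr rfl fun s hs => ?_
      simp [φ, hs]
    · exact fun b hb => if_neg fun h => hb (by simpa using h.1)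
  have h2 : ∀ᵐ f ∂μ, ∑' b, φ b 1 f ≤
      #S * if 1 ∉ inessential G f ∧ f 1 ∈ inessential G f then 1 else 0 := by
    filter_upwards [hmax] with f hf
    split_ifs with h
    · rw [tsum_eq_sum (s := S), mul_one, Finset.card_eq_sum_ones]
      · push_cast
        refine Finset.sum_le_sum fun s _ => ?_
        simp only [φ]
        split_ifs <;> simp
      · refine fun b hb => if_neg fun h => hb ?_
        simpa using hsym _ h.1
    · rw [mul_zero, nonpos_iff_eq_zero, ENNReal.tsum_eq_zero]
      refine fun b => if_neg fun hb => h ⟨hb.2.2, ?_⟩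
      refine hf.apply_mem_inessential hb.2.2 hb.2.1 (SimpleGraph.Adj.symm ?_)
      exact (mulCayley_adj_iff (S := (S : Set Γ)) hsym hone b 1).2 hb.1
  simp only [← h1]
  rw [key, ← lintegral_ite_one ((measurable_mem_inessential G 1).not.and
      (measurable_apply_mem_inessential G 1)), ← lintegral_const_mul]
  · exact lintegral_mono_ae h2
  · exact measurable_ite_one ((measurable_mem_inessential G 1).not.and
      (measurable_apply_mem_inessential G 1))

open Classical in
/-- The expected number of edges leaving the component of a root is at least `#S`. -/
theorem IsInvariant.le_lintegral_boundary [Infinite Γ] [IsProbabilityMeasure μ] {S : Finset Γ}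
    (hμ : IsInvariant μ) (hsym : ∀ s ∈ S, s⁻¹ ∈ S) (hone : (1 : Γ) ∉ S)
    (hgen : Subgroup.closure (S : Set Γ) = ⊤)
    (hmax : ∀ᵐ f ∂μ, IsLocMax (mulCayley (S : Set Γ)) f) :
    #S * μ {f | IsRoot (mulCayley (S : Set Γ)) f 1} ≤
      ∫⁻ f, (∑ s ∈ S, if 1 ∈ inessential (mulCayley (S : Set Γ)) f ∧
        s ∉ inessential (mulCayley (S : Set Γ)) f then 1 else 0) ∂μ := by
  set G := mulCayley (S : Set Γ) with hGdef
  have hG : IsLeftInvariant G := isLeftInvariant_mulCayley _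
  let φ : Γ → Γ → (Γ → Γ) → ℝ≥0∞ := fun a b f =>
    ∑ s ∈ S, if IsRoot G f b ∧ Linked G f a b ∧ a * s ∉ inessential G f then 1 else 0
  have hφ : ∀ a b, Measurable (φ a b) := fun a b =>
    Finset.measurable_sum _ fun s _ => measurable_ite_one ((measurable_isRoot G b).and
      ((measurable_linked G a b).and (measurable_mem_inessential G (a * s)).not))
  have hinv : ∀ g a b f, φ (g * a) (g * b) (conjMap g f) = φ a b f := by
    intro g a b f
    simp only [φ, mul_assoc, mul_mem_inessential hG, isRoot_conjMap hG, linked_conjMap hG]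
  have key := hμ.mass_transport φ hφ hinv
  have h1 : ∀ᵐ f ∂μ, ∑' b, φ 1 b f ≤
      ∑ s ∈ S, if 1 ∈ inessential G f ∧ s ∉ inessential G f then 1 else 0 := by
    filter_upwards [hmax] with f hf
    by_cases h : ∃ b, IsRoot G f b ∧ Linked G f 1 b
    · obtain ⟨b, hb, hl⟩ := h
      rw [tsum_eq_single b]
      · refine Finset.sum_le_sum fun s _ => ?_
        simp [hb, hl, hl.mem_inessential hb.1]
      · intro b' hb'
        refine Finset.sum_eq_zero fun s _ => if_neg fun ⟨h1, h2, _⟩ => hb' ?_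
        exact hf.root_unique h1 hb (h2.symm.trans hl)
    · push Not at h
      rw [ENNReal.tsum_eq_zero.2 fun b => Finset.sum_eq_zero fun s _ =>
        if_neg fun h' => h b h'.1 h'.2.1]
      exact zero_le
  have h2 : ∀ᵐ f ∂μ, (#S * if IsRoot G f 1 then 1 else 0 : ℝ≥0∞) ≤ ∑' b, φ b 1 f := by
    filter_upwards [hmax, hμ.ae_finite_linked hG hmax] with f hf hfin
    split_ifs with hr
    · have hC := hfin hr
      set C := hC.toFinset with hCdef
      have hmem : ∀ a, a ∈ C ↔ Linked G f a 1 := fun a => by simp [hCdef]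
      have hCne : C.Nonempty := ⟨1, (hmem 1).2 Relation.ReflTransGen.refl⟩
      have hb := card_le_edgeBoundary S hone hgen hCne
      rw [tsum_eq_sum (s := C), mul_one]
      · refine (Nat.cast_le.2 hb).trans (le_of_eq ?_)
        unfold edgeBoundary
        push_cast
        refine Finset.sum_congr rfl fun a ha => ?_
        rw [Finset.card_filter]
        push_cast
        refine Finset.sum_congr rfl fun s hs => ?_
        have hal := (hmem a).1 ha
        have haD := hal.mem_inessential hr.1
        have hiff : a * s ∉ C ↔ a * s ∉ inessential G f := by
          refine not_congr ⟨fun h => ((hmem _).1 h).mem_inessential hr.1, fun h => (hmem _).2 ?_⟩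
          refine Relation.ReflTransGen.head ⟨?_, h, haD⟩ hal
          refine ((mulCayley_adj_iff (S := (S : Set Γ)) hsym hone a (a * s)).2 ?_).symm
          simpa using hs
        simp [hr, hal, hiff]
      · intro a ha
        exact Finset.sum_eq_zero fun s _ => if_neg fun h => ha ((hmem a).2 h.2.1)
    · simp
  rw [← lintegral_ite_one (measurable_isRoot G 1), ← lintegral_const_mul _
    (measurable_ite_one (measurable_isRoot G 1))]
  calc _ ≤ _ := lintegral_mono_ae h2
    _ = _ := key.symm
    _ ≤ _ := lintegral_mono_ae h1

/-- A locally maximum invariant random matching is almost surely perfect. -/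
theorem IsInvariant.measure_fixed_eq_zero [Infinite Γ] [IsProbabilityMeasure μ] {S : Finset Γ}
    (hμ : IsInvariant μ) (hsym : ∀ s ∈ S, s⁻¹ ∈ S) (hone : (1 : Γ) ∉ S)
    (hgen : Subgroup.closure (S : Set Γ) = ⊤)
    (hmax : ∀ᵐ f ∂μ, IsLocMax (mulCayley (S : Set Γ)) f) :
    μ {f | f 1 = 1} = 0 := by
  set G := mulCayley (S : Set Γ) with hGdef
  have hG : IsLeftInvariant G := isLeftInvariant_mulCayley _
  have h1 := (hμ.le_lintegral_boundary hsym hone hgen hmax).trans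
    (hμ.lintegral_boundary_le hsym hone hmax)
  rw [← hGdef, hμ.measure_matched_out hG (hmax.mono fun f hf => hf.1)] at h1
  have hS : (#S : ℝ≥0∞) ≠ 0 := by
    rw [Nat.cast_ne_zero, Finset.card_ne_zero]
    by_contra hS
    rw [Finset.not_nonempty_iff_eq_empty] at hS
    rw [hS, Finset.coe_empty, Subgroup.closure_empty] at hgen
    exact bot_ne_top hgen
  have h2 := (ENNReal.mul_le_mul_iff_right hS (ENNReal.natCast_ne_top _)).1 h1
  have h3 : μ {f | IsRoot G f 1} =
      μ {f | f 1 = 1} + μ {f | 1 ∈ inessential G f ∧ f 1 ∉ inessential G f} := by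
    rw [← measure_union]
    · refine measure_congr ?_
      filter_upwards [hmax] with f hf
      refine propext ⟨fun h => h.2.imp id fun h' => ⟨h.1, h'⟩, ?_⟩
      rintro (h | h)
      · exact ⟨mem_inessential_of_fixed hf.1 h, Or.inl h⟩
      · exact ⟨h.1, Or.inr h.2⟩
    · refine Set.disjoint_left.2 fun f hf hf' => hf'.2 ?_
      have : f 1 = 1 := hf
      rw [this]
      exact hf'.1
    · exact measurableSet_setOfPred.2 ((measurable_mem_inessential G 1).and
        (measurable_apply_mem_inessential G 1).not)
  rw [h3] at h2
  by_contra hne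
  exact absurd h2 (not_le.2 (by
    rw [add_comm]; exact ENNReal.lt_add_right (measure_ne_top _ _) hne))

end Saturation

end CayleyMatching

namespace CayleyMatching

open SimpleGraph MeasureTheory

section EdgeConfigurations

variable {Γ : Type*} [Group Γ] (S : Set Γ)

open Classical in
/-- The edge configuration of a matching given as an involution. -/
noncomputable def edgeConfig (f : Γ → Γ) : (mulCayley S).edgeSet → Bool :=
  fun e => decide (∃ v w, f v = w ∧ e.1 = s(v, w))

theorem edgeConfig_eq_true {f : Γ → Γ} {e : (mulCayley S).edgeSet} :
    edgeConfig S f e = true ↔ ∃ v, e.1 = s(v, f v) := by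
  simp [edgeConfig]

theorem configShift_edgeConfig (g : Γ) (f : Γ → Γ) :
    configShift S g (edgeConfig S f) = edgeConfig S (conjMap g f) := by
  ext e
  rw [Bool.eq_iff_iff]
  unfold configShift
  rw [edgeConfig_eq_true, edgeConfig_eq_true]
  have hcomp : ∀ k l : Γ, ∀ z : Sym2 Γ, Sym2.map (fun v => k * v) (Sym2.map (fun v => l * v) z) =
      Sym2.map (fun v => k * l * v) z := by
    intro k l z
    rw [Sym2.map_map]
    congr 1
    ext v
    simp [mul_assoc]
  constructor
  · rintro ⟨v, hv⟩
    refine ⟨g * v, ?_⟩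
    have := congrArg (Sym2.map (fun v => g * v)) hv
    simpa [edgeShift, hcomp, conjMap_mul_apply] using this
  · rintro ⟨v, hv⟩
    refine ⟨g⁻¹ * v, ?_⟩
    simp [edgeShift, hv, conjMap]

theorem measurable_edgeConfig [Countable Γ] [MeasurableSpace Γ] [MeasurableSingletonClass Γ] :
    Measurable (edgeConfig S) := by
  refine measurable_pi_lambda _ fun e => measurable_to_bool ?_
  have : (fun f : Γ → Γ => edgeConfig S f e) ⁻¹' {true} =
      {f | ∃ v w, f v = w ∧ e.1 = s(v, w)} := by
    ext f
    simp [edgeConfig]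
  rw [this]
  exact measurableSet_setOfPred.2 (Measurable.exists fun v => Measurable.exists fun w =>
    (measurable_apply_eq v w).and measurable_const)

theorem isPerfectMatching_edgeConfig {f : Γ → Γ} (hf : IsMatchingMap (mulCayley S) f)
    (hne : ∀ v, f v ≠ v) : IsPerfectMatching (mulCayley S) {e | edgeConfig S f e = true} := by
  intro v
  have hadj : (mulCayley S).Adj v (f v) := (hf.adj v).resolve_left (hne v)
  refine ⟨⟨s(v, f v), hadj⟩, ⟨(edgeConfig_eq_true S).2 ⟨v, rfl⟩, by simp⟩, ?_⟩
  rintro ⟨e, he⟩ ⟨h1, h2⟩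
  obtain ⟨u, hu⟩ := (edgeConfig_eq_true S).1 h1
  simp only at hu h2
  subst hu
  refine Subtype.ext ?_
  rcases Sym2.mem_iff.1 h2 with rfl | rfl
  · rfl
  · simp only [hf.invol]
    exact Sym2.eq_swap

theorem measurable_isPerfectMatching {V : Type*} [Countable V] (G : SimpleGraph V) :
    Measurable fun ω : G.edgeSet → Bool => IsPerfectMatching G {e | ω e = true} := by
  have : Countable (Sym2 V) := Quot.mk_surjective.countable
  have h : ∀ e : G.edgeSet, Measurable fun ω : G.edgeSet → Bool => ω e = true := fun e =>
    measurableSet_setOfPred.1 (measurableSet_eq_fun (measurable_pi_apply e) measurable_const)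
  unfold IsPerfectMatching ExistsUnique
  refine Measurable.forall fun v => Measurable.exists fun e => Measurable.and ?_ ?_
  · exact (h e).and measurable_const
  · exact Measurable.forall fun e' => ((h e').and measurable_const).imp measurable_const

end EdgeConfigurations

theorem countable_of_closure_eq_top {Γ : Type*} [Group Γ] {S : Set Γ} (hS : S.Countable)
    (hgen : Subgroup.closure S = ⊤) : Countable Γ := by
  have := hS.to_subtype
  have : Countable (FreeGroup S) := Quot.mk_surjective.countable
  refine Function.Surjective.countable (f := FreeGroup.lift ((↑) : S → Γ)) ?_
  rw [← MonoidHom.range_eq_top, FreeGroup.range_lift_eq_closure, Subtype.range_coe, hgen]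

end CayleyMatching

open MeasureTheory in
theorem invariant_random_perfect_matching {Γ : Type*} [Group Γ] [Infinite Γ]
    (S : Set Γ) (hfin : S.Finite) (hsym : ∀ s ∈ S, s⁻¹ ∈ S) (hone : (1 : Γ) ∉ S)
    (hgen : Subgroup.closure S = ⊤) :
    ∃ ν : Measure ((SimpleGraph.mulCayley S).edgeSet → Bool),
      IsProbabilityMeasure ν ∧
      (∀ g : Γ, MeasurePreserving (CayleyMatching.configShift S g) ν ν) ∧
      ∀ᵐ ω ∂ν, CayleyMatching.IsPerfectMatching (SimpleGraph.mulCayley S)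
        {e | ω e = true} := by
  open CayleyMatching in
  have hcount : Countable Γ := countable_of_closure_eq_top hfin.countable hgen
  let _ : TopologicalSpace Γ := ⊥
  have : DiscreteTopology Γ := ⟨rfl⟩
  let _ : MeasurableSpace Γ := borel Γ
  have : BorelSpace Γ := ⟨rfl⟩
  have hG := isLeftInvariant_mulCayley S
  obtain ⟨μ, hμ, hmin⟩ := exists_minimizing_invariantMatching (G := SimpleGraph.mulCayley S)
    (fun v => (hfin.image (v * ·)).subset fun w hw =>
      ⟨v⁻¹ * w, (mulCayley_adj_iff hsym hone v w).1 hw, by simp⟩)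
  have := hμ.prob
  have hmax := hμ.ae_isLocMax hG hmin
  have hzero : μ {f | f 1 = 1} = 0 := by
    lift S to Finset Γ using hfin
    exact hμ.invariant.measure_fixed_eq_zero hsym hone hgen hmax
  have hperfect : ∀ᵐ f ∂μ, ∀ v : Γ, f v ≠ v := by
    refine ae_all_iff.2 fun v => ?_
    suffices h : μ {f | f v = v} = 0 from measure_eq_zero_iff_ae_notMem.1 h
    rw [← (hμ.invariant v).measure_preimage
      (measurableSet_setOfPred.2 (measurable_apply_eq v v)).nullMeasurableSet, ← hzero]
    congr 1
    ext f
    simpa using conjMap_apply_eq_iff v f 1 1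
  have hmeas := measurable_edgeConfig S
  refine ⟨μ.map (edgeConfig S), Measure.isProbabilityMeasure_map hmeas.aemeasurable,
    fun g => ?_, ?_⟩
  · have hshift : Measurable (configShift S g) :=
      measurable_pi_lambda _ fun e => measurable_pi_apply _
    refine ⟨hshift, ?_⟩
    rw [Measure.map_map hshift hmeas]
    have : configShift S g ∘ edgeConfig S = edgeConfig S ∘ conjMap g := by
      ext1 f
      exact configShift_edgeConfig S g f
    rw [this, ← Measure.map_map hmeas (measurable_conjMap g), (hμ.invariant g).map_eq]
  · rw [ae_map_iff hmeas.aemeasurable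
      (measurableSet_setOfPred.2 (measurable_isPerfectMatching (SimpleGraph.mulCayley S)))]
    filter_upwards [hμ.matching, hperfect] with f hf hne
    exact isPerfectMatching_edgeConfig S hf hne
end
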